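/- arXiv:1403.2457 — 2 statements merged into one kernel-verified Lean document; each statement's English description precedes it below -/
import Mathlib

section
/- Let (X, S, μ) be a probability space and let C ⊆ S be a family of measurable sets with H_μ(C) = 0. Then for every ergodic measure-preserving transformation T of (X, S, μ), sup_{C ∈ C} ∫ |(1/n) Σ_{i=0}^{n-1} 1_C(T^i x) − μ(C)| dμ(x) → 0 as n → ∞. -/
open MeasureTheory Filter

/-- Entropy (base 2) of the join of the sets `C 0, …, C (n-1)`: the cells of the join are
indexed by sign patterns `s : Fin n → Bool`; cells of measure zero contribute `0`. -/
noncomputable def joinEntropy {X : Type*} [MeasurableSpace X] (μ : Measure X)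
    {n : ℕ} (C : Fin n → Set X) : ℝ :=
  ∑ s : Fin n → Bool,
    -((μ (⋂ i, if s i then C i else (C i)ᶜ)).toReal *
      Real.logb 2 (μ (⋂ i, if s i then C i else (C i)ᶜ)).toReal)

/-- Entropy of a family `𝒞` of measurable sets: the supremum over all sequences of sets
from `𝒞` of `liminf (1/n) H_μ(⋁_{i<n} C_i)`. -/
noncomputable def famEntropy {X : Type*} [MeasurableSpace X] (μ : Measure X)
    (𝒞 : Set (Set X)) : ℝ :=
  ⨆ S : {f : ℕ → Set X // ∀ i, f i ∈ 𝒞},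
    Filter.liminf (fun n : ℕ => joinEntropy μ (fun i : Fin n => S.1 i) / n) Filter.atTop

/-- The mean deviation `∫ |(1/n) ∑_{i<n} 1_C(T^i x) − μ(C)| dμ` of the Birkhoff average. -/
noncomputable def birkDev {X : Type*} [MeasurableSpace X] (μ : Measure X)
    (T : X → X) (C : Set X) (n : ℕ) : ℝ :=
  ∫ x, |(∑ i ∈ Finset.range n, C.indicator (fun _ => (1 : ℝ)) (T^[i] x)) / n - (μ C).toReal| ∂μ


lemma phi_ineq {a b : ℝ} (ha : 0 ≤ a) (hb : 0 ≤ b) :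
    -((a + b) * Real.logb 2 (a + b)) + min a b ≤ -(a * Real.logb 2 a) + -(b * Real.logb 2 b) := by
  have key : ∀ a b : ℝ, 0 ≤ a → a ≤ b → 
      -((a + b) * Real.logb 2 (a + b)) + a ≤ -(a * Real.logb 2 a) + -(b * Real.logb 2 b) := by
    intro a b ha hab
    rcases ha.eq_or_lt with rfl | ha
    · simp
    have hb : 0 < b := ha.trans_le hab
    have h1 : Real.logb 2 (2 * a) ≤ Real.logb 2 (a + b) :=
      Real.logb_le_logb_of_le (by norm_num) (by positivity) (by linarith)
    have h2 : Real.logb 2 b ≤ Real.logb 2 (a + b) :=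
      Real.logb_le_logb_of_le (by norm_num) (by positivity) (by linarith)
    rw [Real.logb_mul (by norm_num) ha.ne', Real.logb_self_eq_one (by norm_num)] at h1
    nlinarith
  rcases le_total a b with h | h
  · rw [min_eq_left h]; exact key a b ha h
  · rw [min_eq_right h]
    have := key b a hb h
    rw [add_comm b a] at this
    linarith

/-- cell of the join -/
def cellOf {X : Type*} {n : ℕ} (C : Fin n → Set X) (s : Fin n → Bool) : Set X :=
  ⋂ i, if s i then C i else (C i)ᶜ

lemma measurableSet_cellOf {X : Type*} [MeasurableSpace X] {n : ℕ} {C : Fin n → Set X}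
    (h : ∀ i, MeasurableSet (C i)) (s : Fin n → Bool) : MeasurableSet (cellOf C s) := by
  refine MeasurableSet.iInter fun i => ?_
  split_ifs
  · exact h i
  · exact (h i).compl

lemma mem_cellOf {X : Type*} {n : ℕ} (C : Fin n → Set X) (x : X) : ∃ s, x ∈ cellOf C s := by
  classical
  refine ⟨fun i => decide (x ∈ C i), ?_⟩
  simp only [cellOf, Set.mem_iInter]
  intro i
  by_cases h : x ∈ C i <;> simp [h]

lemma cellOf_snoc {X : Type*} {n : ℕ} (C : ℕ → Set X) (s : Fin n → Bool) (b : Bool) :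
    cellOf (fun i : Fin (n+1) => C i) (Fin.snoc (α := fun _ => Bool) s b) =
      cellOf (fun i : Fin n => C i) s ∩ (if b then C n else (C n)ᶜ) := by
  ext x
  simp only [cellOf, Set.mem_iInter, Set.mem_inter_iff, Fin.forall_fin_succ']
  simp

/-- gain -/
noncomputable def gain {X : Type*} [MeasurableSpace X] (μ : Measure X)
    {n : ℕ} (C : Fin n → Set X) (D : Set X) : ℝ :=
  ∑ s : Fin n → Bool, min (μ.real (cellOf C s ∩ D)) (μ.real (cellOf C s \ D))

lemma joinEntropy_succ {X : Type*} [MeasurableSpace X] (μ : Measure X) [IsProbabilityMeasure μ]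
    (C : ℕ → Set X) (h : ∀ i, MeasurableSet (C i)) (n : ℕ) :
    joinEntropy μ (fun i : Fin n => C i) + gain μ (fun i : Fin n => C i) (C n) ≤
      joinEntropy μ (fun i : Fin (n+1) => C i) := by
  unfold joinEntropy gain
  rw [← Finset.sum_add_distrib, 
    ← (Fin.snocEquiv (n := n) (fun _ => Bool)).sum_comp, Fintype.sum_prod_type_right]
  refine Finset.sum_le_sum fun s _ => ?_
  have e : ∀ b, (⋂ i : Fin (n+1), if (Fin.snocEquiv (n := n) (fun _ => Bool)) (b, s) i = true 
      then C i else (C i)ᶜ) = cellOf (fun i : Fin n => C i) s ∩ (if b then C n else (C n)ᶜ) := by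
    intro b
    rw [← cellOf_snoc]; rfl
  rw [Fintype.sum_bool, e, e]
  have := phi_ineq (a := μ.real (cellOf (fun i : Fin n => C i) s ∩ C n))
    (b := μ.real (cellOf (fun i : Fin n => C i) s \ C n)) (by positivity) (by positivity)
  rw [measureReal_inter_add_sdiff (h n)] at this
  simpa [Measure.real, cellOf, Set.sdiff_eq] using this

lemma phi_ineq_up {a b : ℝ} (ha : 0 ≤ a) (hb : 0 ≤ b) :
    -(a * Real.logb 2 a) + -(b * Real.logb 2 b) ≤ -((a + b) * Real.logb 2 (a + b)) + (a + b) := by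
  rcases (add_nonneg ha hb).eq_or_lt with h0 | h0
  · have h1 : a = 0 := by linarith
    have h2 : b = 0 := by linarith
    simp [h1, h2]
  have h := (Real.concaveOn_negMulLog).2 ha hb
    (by norm_num : (0:ℝ) ≤ 1/2) (by norm_num : (0:ℝ) ≤ 1/2) (by norm_num)
  simp only [smul_eq_mul, Real.negMulLog] at h
  rw [← mul_add, ← mul_add, Real.log_mul (by norm_num) h0.ne', one_div, Real.log_inv] at h
  have h2 : 0 < Real.log 2 := Real.log_pos (by norm_num)
  simp only [Real.logb]
  rw [← sub_nonneg]
  have e : (-((a + b) * (Real.log (a + b) / Real.log 2)) + (a + b)) -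
    (-(a * (Real.log a / Real.log 2)) + -(b * (Real.log b / Real.log 2))) =
    (-((a + b) * (Real.log (a + b))) + (a + b) * Real.log 2 + a * Real.log a + b * Real.log b)
      / Real.log 2 := by
    field_simp
    ring
  rw [e]
  apply div_nonneg _ h2.le
  nlinarith

lemma sum_cells {X : Type*} [MeasurableSpace X] (μ : Measure X) [IsProbabilityMeasure μ]
    (C : ℕ → Set X) (h : ∀ i, MeasurableSet (C i)) (n : ℕ) :
    ∑ s : Fin n → Bool, μ.real (cellOf (fun i : Fin n => C i) s) = 1 := by
  induction n with
  | zero => simp [cellOf]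
  | succ n ih =>
    rw [← ih, ← (Fin.snocEquiv (n := n) (fun _ => Bool)).sum_comp, Fintype.sum_prod_type_right]
    refine Finset.sum_congr rfl fun s _ => ?_
    have e : ∀ b, cellOf (fun i : Fin (n+1) => C i) ((Fin.snocEquiv (n := n) (fun _ => Bool)) (b, s))
       = cellOf (fun i : Fin n => C i) s ∩ (if b then C n else (C n)ᶜ) := by
      intro b
      rw [← cellOf_snoc]; rfl
    rw [Fintype.sum_bool, e, e, ← measureReal_inter_add_sdiff (s := cellOf (fun i : Fin n => C i) s) (h n)]
    simp [Set.sdiff_eq]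

lemma joinEntropy_le {X : Type*} [MeasurableSpace X] (μ : Measure X) [IsProbabilityMeasure μ]
    (C : ℕ → Set X) (h : ∀ i, MeasurableSet (C i)) (n : ℕ) :
    joinEntropy μ (fun i : Fin n => C i) ≤ n := by
  induction n with
  | zero => simp [joinEntropy]
  | succ n ih =>
    push_cast
    refine le_trans ?_ (add_le_add_left ih 1)
    rw [← sum_cells μ C h n]
    unfold joinEntropy
    rw [← Finset.sum_add_distrib, 
      ← (Fin.snocEquiv (n := n) (fun _ => Bool)).sum_comp, Fintype.sum_prod_type_right]
    refine Finset.sum_le_sum fun s _ => ?_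
    have e : ∀ b, (⋂ i : Fin (n+1), if (Fin.snocEquiv (n := n) (fun _ => Bool)) (b, s) i = true 
        then C i else (C i)ᶜ) = cellOf (fun i : Fin n => C i) s ∩ (if b then C n else (C n)ᶜ) := by
      intro b
      rw [← cellOf_snoc]; rfl
    rw [Fintype.sum_bool, e, e]
    have := phi_ineq_up (a := μ.real (cellOf (fun i : Fin n => C i) s ∩ C n))
      (b := μ.real (cellOf (fun i : Fin n => C i) s \ C n)) (by positivity) (by positivity)
    rw [measureReal_inter_add_sdiff (h n)] at this
    simpa [Measure.real, cellOf, Set.sdiff_eq] using this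

/-- greedy sequence -/
noncomputable def greedy {α : Type*} (next : ∀ n : ℕ, (Fin n → α) → α) (n : ℕ) : α :=
  next n (fun i => greedy next i.1)
termination_by n
decreasing_by exact i.2

lemma exists_gain_lt {X : Type*} [MeasurableSpace X] (μ : Measure X) [IsProbabilityMeasure μ]
    (𝒞 : Set (Set X)) (h𝒞 : ∀ C ∈ 𝒞, MeasurableSet C) (hent : famEntropy μ 𝒞 = 0)
    {ε : ℝ} (hε : 0 < ε) :
    ∃ (n : ℕ) (S : Fin n → Set X), (∀ i, MeasurableSet (S i)) ∧ ∀ D ∈ 𝒞, gain μ S D < ε := by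
  by_contra! hcon
  have hcon' : ∀ (n : ℕ) (S : Fin n → 𝒞), ∃ D : 𝒞, ε ≤ gain μ (fun i => (S i : Set X)) D := by
    intro n S
    obtain ⟨D, hD, h⟩ := hcon n (fun i => S i) (fun i => h𝒞 _ (S i).2)
    exact ⟨⟨D, hD⟩, h⟩
  choose next hnext using hcon'
  let S : ℕ → Set X := fun n => (greedy (α := 𝒞) next n : 𝒞)
  have hS : ∀ n, S n ∈ 𝒞 := fun n => (greedy (α := 𝒞) next n).2
  have hg : ∀ n, ε ≤ gain μ (fun i : Fin n => S i) (S n) := by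
    intro n
    have := hnext n (fun i => greedy (α := 𝒞) next i.1)
    simp only [S]
    rw [greedy]
    exact this
  have hlow : ∀ n : ℕ, n * ε ≤ joinEntropy μ (fun i : Fin n => S i) := by
    intro n
    induction n with
    | zero => simp [joinEntropy]
    | succ n ih =>
      have := joinEntropy_succ μ S (fun i => h𝒞 _ (hS i)) n
      have := hg n
      push_cast
      linarith
  have hup : ∀ (f : ℕ → Set X) (_ : ∀ i, f i ∈ 𝒞) (n : ℕ),
      joinEntropy μ (fun i : Fin n => f i) / n ≤ 1 := by
    intro f hf n
    exact div_le_one_of_le₀ (joinEntropy_le μ f (fun i => h𝒞 _ (hf i)) n) (by positivity)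
  have hcob : ∀ (f : ℕ → Set X) (_ : ∀ i, f i ∈ 𝒞), IsCoboundedUnder (· ≥ ·) atTop
      (fun n : ℕ => joinEntropy μ (fun i : Fin n => f i) / n) := by
    intro f hf
    exact (isBoundedUnder_of ⟨1, hup f hf⟩ : IsBoundedUnder (· ≤ ·) atTop _).isCoboundedUnder_ge
  have hnn : ∀ (f : ℕ → Set X) (n : ℕ),
      0 ≤ joinEntropy μ (fun i : Fin n => f i) / n := by
    intro f n
    refine div_nonneg (Finset.sum_nonneg fun s _ => ?_) (by positivity)
    rw [neg_nonneg]
    exact mul_nonpos_of_nonneg_of_nonpos ENNReal.toReal_nonneg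
      (Real.logb_nonpos (by norm_num) ENNReal.toReal_nonneg measureReal_le_one)
  have hbdd : BddAbove (Set.range fun S : {f : ℕ → Set X // ∀ i, f i ∈ 𝒞} =>
    Filter.liminf (fun n : ℕ => joinEntropy μ (fun i : Fin n => S.1 i) / n) Filter.atTop) := by
    refine ⟨1, ?_⟩
    rintro _ ⟨f, rfl⟩
    exact liminf_le_of_frequently_le (Frequently.of_forall (hup f.1 f.2)) 
      (isBoundedUnder_of ⟨0, hnn f.1⟩)
  have h1 := le_ciSup hbdd ⟨S, hS⟩
  have h2 : ε ≤ Filter.liminf (fun n : ℕ => joinEntropy μ (fun i : Fin n => S i) / n) atTop := by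
    refine le_liminf_of_le (hcob S hS) ?_
    filter_upwards [eventually_gt_atTop 0] with n hn
    have : (0:ℝ) < n := by exact_mod_cast hn
    rw [le_div_iff₀ this, mul_comm]
    exact hlow n
  have h3 : (⨆ S : {f : ℕ → Set X // ∀ i, f i ∈ 𝒞},
    Filter.liminf (fun n : ℕ => joinEntropy μ (fun i : Fin n => S.1 i) / n) Filter.atTop) = 0 := hent
  rw [h3] at h1
  simp only at h1
  linarith

lemma exists_finite_approx {X : Type*} [MeasurableSpace X] (μ : Measure X) [IsProbabilityMeasure μ]
    (𝒞 : Set (Set X)) (h𝒞 : ∀ C ∈ 𝒞, MeasurableSet C) (hent : famEntropy μ 𝒞 = 0)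
    {ε : ℝ} (hε : 0 < ε) :
    ∃ (ι : Type) (_ : Finite ι) (U : ι → Set X), (∀ i, MeasurableSet (U i)) ∧
      ∀ C ∈ 𝒞, ∃ i, μ.real (C \ U i) + μ.real (U i \ C) < ε := by
  classical
  obtain ⟨n, S, hS, h⟩ := exists_gain_lt μ 𝒞 h𝒞 hent hε
  refine ⟨Finset (Fin n → Bool), inferInstance, fun t => ⋃ s ∈ t, cellOf S s, fun t =>
    t.measurableSet_biUnion fun s _ => measurableSet_cellOf hS s, ?_⟩
  intro C hC
  let t : Finset (Fin n → Bool) := 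
    {s | μ.real (cellOf S s \ C) ≤ μ.real (cellOf S s ∩ C)}
  refine ⟨t, lt_of_le_of_lt ?_ (h C hC)⟩
  have h1 : μ.real (C \ ⋃ s ∈ t, cellOf S s) ≤ ∑ s ∈ tᶜ, μ.real (cellOf S s ∩ C) := by
    refine le_trans (measureReal_mono ?_ (measure_ne_top _ _)) (measureReal_biUnion_finset_le _ _)
    rintro x ⟨hx, hxU⟩
    obtain ⟨s, hs⟩ := mem_cellOf S x
    simp only [Set.mem_iUnion, not_exists] at hxU ⊢
    exact ⟨s, by simpa using fun hst => hxU s hst hs, hs, hx⟩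
  have h2 : μ.real ((⋃ s ∈ t, cellOf S s) \ C) ≤ ∑ s ∈ t, μ.real (cellOf S s \ C) := by
    refine le_trans (measureReal_mono ?_ (measure_ne_top _ _)) (measureReal_biUnion_finset_le _ _)
    rintro x ⟨hx, hxU⟩
    simp only [Set.mem_iUnion] at hx ⊢
    obtain ⟨s, hst, hs⟩ := hx
    exact ⟨s, hst, hs, hxU⟩
  refine (add_le_add h1 h2).trans ?_
  unfold gain
  rw [← Finset.sum_compl_add_sum t]
  refine add_le_add (Finset.sum_le_sum fun s hs => ?_) (Finset.sum_le_sum fun s hs => ?_)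
  · rw [min_eq_left]
    have : μ.real (cellOf S s ∩ C) < μ.real (cellOf S s \ C) := by simpa [t] using hs
    exact this.le
  · rw [min_eq_right]
    simpa [t] using hs

lemma tendsto_birkDev {X : Type*} [MeasurableSpace X] (μ : Measure X) [IsProbabilityMeasure μ]
    (T : X → X) (hT : Ergodic T μ) (U : Set X) (hU : MeasurableSet U) :
    Tendsto (birkDev μ T U) atTop (nhds 0) := by
  have hmp : MeasurePreserving T μ μ := hT.toMeasurePreserving
  let K : Lp ℝ 2 μ →L[ℝ] Lp ℝ 2 μ := 
    (Lp.compMeasurePreservingₗᵢ (E := ℝ) (p := 2) ℝ T hmp).toContinuousLinearMap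
  have hKc : (K : Lp ℝ 2 μ → Lp ℝ 2 μ) = Lp.compMeasurePreserving T hmp := rfl
  have hK : ‖K‖ ≤ 1 := LinearIsometry.norm_toContinuousLinearMap_le _
  let F : Lp ℝ 2 μ := indicatorConstLp 2 hU (measure_ne_top μ U) (1:ℝ)
  let I : Lp ℝ 2 μ := indicatorConstLp 2 MeasurableSet.univ (measure_ne_top μ _) (1:ℝ)
  let V := K.eqLocus (1 : Lp ℝ 2 μ →L[ℝ] Lp ℝ 2 μ)
  let P : Lp ℝ 2 μ := V.orthogonalProjectionOnto F
  have hlim : Tendsto (birkhoffAverage ℝ K _root_.id · F) atTop (nhds P) :=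
    K.tendsto_birkhoffAverage_orthogonalProjection hK F
  have hPV : P ∈ V := (V.orthogonalProjectionOnto F).2
  have hIV : I ∈ V := by
    change K I = I
    rfl
  obtain ⟨c, hc⟩ : ∃ c, P =ᵐ[μ] Function.const X c := by
    refine hT.ae_eq_const_of_ae_eq_comp_ae (Lp.aestronglyMeasurable P) ?_
    have h : Lp.compMeasurePreserving T hmp P = P := hPV
    have h2 := Lp.coeFn_compMeasurePreserving P hmp
    rw [h] at h2
    exact h2.symm
  have hcU : c = μ.real U := by
    have h := V.starProjection_inner_eq_zero F I hIV
    have h' : inner ℝ I (F - P) = 0 := by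
      rw [real_inner_comm]; exact h
    rw [inner_sub_right, L2.inner_indicatorConstLp_one, L2.inner_indicatorConstLp_one] at h'
    rw [setIntegral_univ, setIntegral_univ, integral_congr_ae hc, 
      integral_congr_ae indicatorConstLp_coeFn, integral_indicator_const _ hU] at h'
    simp at h'
    linarith
  have hsum : ∀ n : ℕ, (birkhoffSum K _root_.id n F : Lp ℝ 2 μ) =ᵐ[μ]
      fun x => ∑ i ∈ Finset.range n, U.indicator (fun _ => (1 : ℝ)) (T^[i] x) := by
    intro n
    induction n with
    | zero => 
      rw [birkhoffSum_zero]
      filter_upwards [Lp.coeFn_zero ℝ 2 μ] with x hx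
      simp
    | succ n ih =>
      rw [birkhoffSum_succ]
      have h1 : _root_.id (K^[n] F) = Lp.compMeasurePreserving T^[n] (hmp.iterate n) F := by
        rw [← Lp.compMeasurePreserving_iterate hmp n]; rfl
      rw [h1]
      have h3 : (F : X → ℝ) =ᵐ[μ] _ := indicatorConstLp_coeFn
      have h4 := (hmp.iterate n).quasiMeasurePreserving.ae_eq_comp h3
      filter_upwards [Lp.coeFn_add (birkhoffSum K _root_.id n F) 
        (Lp.compMeasurePreserving T^[n] (hmp.iterate n) F), ih, 
        Lp.coeFn_compMeasurePreserving F (hmp.iterate n), h4] with x a1 a2 a3 a4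
      rw [a1, Pi.add_apply, a2, a3, a4, Finset.sum_range_succ]
      rfl
  have hle : ∀ n, birkDev μ T U n ≤ ‖birkhoffAverage ℝ K _root_.id n F - P‖ := by
    intro n
    have hae : (birkhoffAverage ℝ K _root_.id n F - P : Lp ℝ 2 μ) =ᵐ[μ] fun x =>
      (∑ i ∈ Finset.range n, U.indicator (fun _ => (1 : ℝ)) (T^[i] x)) / n - (μ U).toReal := by
      filter_upwards [Lp.coeFn_sub (birkhoffAverage ℝ K _root_.id n F) P, 
        Lp.coeFn_smul ((n:ℝ)⁻¹) (birkhoffSum K _root_.id n F), hsum n, hc] with x a1 a2 a3 a4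
      rw [a1, Pi.sub_apply, a4, hcU]
      unfold birkhoffAverage
      rw [a2, Pi.smul_apply, a3, smul_eq_mul]
      simp only [Function.const, Measure.real]
      ring
    set G := birkhoffAverage ℝ K _root_.id n F - P with hG
    have e1 : birkDev μ T U n = (eLpNorm G 1 μ).toReal := by
      rw [eLpNorm_one_eq_lintegral_enorm, 
        ← integral_norm_eq_lintegral_enorm (Lp.aestronglyMeasurable G)]
      unfold birkDev
      refine integral_congr_ae ?_
      filter_upwards [hae] with x hx
      rw [hx, Real.norm_eq_abs]
    rw [e1, Lp.norm_def]
    exact ENNReal.toReal_mono (Lp.eLpNorm_ne_top G) (eLpNorm_le_eLpNorm_of_exponent_le 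
      (by norm_num) (Lp.aestronglyMeasurable G))
  refine squeeze_zero (fun n => integral_nonneg fun x => abs_nonneg _) hle ?_
  exact tendsto_iff_norm_sub_tendsto_zero.1 hlim

lemma birkDev_le {X : Type*} [MeasurableSpace X] (μ : Measure X) [IsProbabilityMeasure μ]
    (T : X → X) (hT : MeasurePreserving T μ μ) (C U : Set X) (hC : MeasurableSet C)
    (hU : MeasurableSet U) (n : ℕ) :
    birkDev μ T C n ≤ birkDev μ T U n + 2 * (μ.real (C \ U) + μ.real (U \ C)) := by
  set δ := μ.real (C \ U) + μ.real (U \ C) with hδ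
  have hδ0 : 0 ≤ δ := by positivity
  let g : X → ℝ := fun x => (C \ U).indicator (fun _ => (1:ℝ)) x + (U \ C).indicator (fun _ => (1:ℝ)) x
  have hgi : Integrable g μ := 
    ((integrable_const 1).indicator (hC.diff hU)).add ((integrable_const 1).indicator (hU.diff hC))
  have hgint : ∫ x, g x ∂μ = δ := by
    rw [integral_add ((integrable_const 1).indicator (hC.diff hU)) 
      ((integrable_const 1).indicator (hU.diff hC)), integral_indicator_const _ (hC.diff hU),
      integral_indicator_const _ (hU.diff hC)]
    simp [hδ]
  have hpt : ∀ x, |C.indicator (fun _ => (1:ℝ)) x - U.indicator (fun _ => (1:ℝ)) x| ≤ g x := by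
    intro x
    by_cases h1 : x ∈ C <;> by_cases h2 : x ∈ U <;> simp [g, h1, h2]
  have hμ : |(μ C).toReal - (μ U).toReal| ≤ δ := by
    have e1 := measureReal_inter_add_sdiff (μ := μ) (s := C) hU
    have e2 := measureReal_inter_add_sdiff (μ := μ) (s := U) hC
    rw [Set.inter_comm] at e2
    have p1 : 0 ≤ μ.real (C \ U) := by positivity
    have p2 : 0 ≤ μ.real (U \ C) := by positivity
    change |μ.real C - μ.real U| ≤ _
    rw [abs_le]; constructor <;> linarith
  have hgT : ∀ i, Integrable (fun x => g (T^[i] x)) μ := fun i =>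
    (hT.iterate i).integrable_comp_of_integrable hgi
  have hgTint : ∀ i, ∫ x, g (T^[i] x) ∂μ = δ := by
    intro i
    rw [← hgint, ← integral_map (hT.iterate i).measurable.aemeasurable, (hT.iterate i).map_eq]
    rw [(hT.iterate i).map_eq]
    exact hgi.aestronglyMeasurable
  have hind : ∀ (D : Set X), MeasurableSet D → Integrable (fun x => 
      |(∑ i ∈ Finset.range n, D.indicator (fun _ => (1 : ℝ)) (T^[i] x)) / n - (μ D).toReal|) μ := by
    intro D hD
    refine (((integrable_finsetSum _ fun i _ => ?_).div_const _).sub (integrable_const _)).abs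
    exact (hT.iterate i).integrable_comp_of_integrable ((integrable_const (1:ℝ)).indicator hD)
  have hgs : Integrable (fun x => (∑ i ∈ Finset.range n, g (T^[i] x)) / n) μ :=
    (integrable_finsetSum _ fun i _ => hgT i).div_const _
  have hgsint : ∫ x, (∑ i ∈ Finset.range n, g (T^[i] x)) / n ∂μ ≤ δ := by
    rw [integral_div, integral_finsetSum _ fun i _ => hgT i]
    simp only [hgTint]
    simp only [Finset.sum_const, Finset.card_range, nsmul_eq_mul]
    exact div_le_of_le_mul₀ (by positivity) hδ0 (by rw [mul_comm])
  calc birkDev μ T C n ≤ ∫ x, ((|(∑ i ∈ Finset.range n, U.indicator (fun _ => (1 : ℝ)) (T^[i] x)) / n 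
        - (μ U).toReal| + (∑ i ∈ Finset.range n, g (T^[i] x)) / n) + δ) ∂μ := by
        refine integral_mono (hind C hC) (((hind U hU).add hgs).add (integrable_const _)) fun x => ?_
        simp only
        have h1 : |(∑ i ∈ Finset.range n, C.indicator (fun _ => (1 : ℝ)) (T^[i] x)) / n 
          - (∑ i ∈ Finset.range n, U.indicator (fun _ => (1 : ℝ)) (T^[i] x)) / n| ≤
          (∑ i ∈ Finset.range n, g (T^[i] x)) / n := by
          rw [← sub_div, ← Finset.sum_sub_distrib, abs_div, Nat.abs_cast]
          gcongr
          exact (Finset.abs_sum_le_sum_abs _ _).trans (Finset.sum_le_sum fun i _ => hpt _)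
        rw [abs_le] at h1 hμ
        have h3 := neg_abs_le ((∑ i ∈ Finset.range n, U.indicator (fun _ => (1 : ℝ)) (T^[i] x)) / n 
          - (μ U).toReal)
        have h4 := le_abs_self ((∑ i ∈ Finset.range n, U.indicator (fun _ => (1 : ℝ)) (T^[i] x)) / n 
          - (μ U).toReal)
        rw [abs_le]
        constructor <;> linarith [h1.1, h1.2, hμ.1, hμ.2]
    _ = birkDev μ T U n + ∫ x, (∑ i ∈ Finset.range n, g (T^[i] x)) / n ∂μ + δ := by
        have e1 := integral_add ((hind U hU).add hgs) (integrable_const (μ := μ) δ)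
        have e2 := integral_add (hind U hU) hgs
        simp only [Pi.add_apply] at e1 e2
        rw [e1, e2]
        simp [birkDev]
    _ ≤ _ := by linarith

/-- If `H_μ(𝒞) = 0`, the uniform mean ergodic theorem holds for `𝒞` under every ergodic
measure preserving transformation of the probability space `(X, 𝒮, μ)`. -/
theorem uniform_mean_ergodic_of_zero_entropy
    {X : Type*} [MeasurableSpace X] (μ : Measure X) [IsProbabilityMeasure μ]
    (𝒞 : Set (Set X)) (h𝒞 : ∀ C ∈ 𝒞, MeasurableSet C) (hent : famEntropy μ 𝒞 = 0)
    (T : X → X) (hT : Ergodic T μ) :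
    Tendsto (fun n : ℕ => ⨆ C : 𝒞, birkDev μ T C n) atTop (nhds 0) := by
  rw [Metric.tendsto_atTop']
  intro ε hε
  obtain ⟨ι, hι, U, hU, happ⟩ := exists_finite_approx μ 𝒞 h𝒞 hent (ε := ε / 8) (by positivity)
  have hev : ∀ᶠ n in atTop, ∀ i, birkDev μ T (U i) n < ε / 4 := by
    rw [eventually_all]
    intro i
    exact (tendsto_birkDev μ T hT (U i) (hU i)).eventually (gt_mem_nhds (by positivity))
  obtain ⟨N, hN⟩ := eventually_atTop.1 hev
  refine ⟨N, fun n hn => ?_⟩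
  have h0 : 0 ≤ ⨆ C : 𝒞, birkDev μ T C n :=
    Real.iSup_nonneg fun C => integral_nonneg fun x => abs_nonneg _
  have h1 : ⨆ C : 𝒞, birkDev μ T C n ≤ ε / 2 := by
    refine Real.iSup_le (fun C => ?_) (by positivity)
    obtain ⟨i, hi⟩ := happ C C.2
    have := birkDev_le μ T hT.toMeasurePreserving C (U i) (h𝒞 _ C.2) (hU i) n
    have := hN n hn.le i
    linarith
  rw [Real.dist_eq, sub_zero, abs_of_nonneg h0]
  linarith
end

section
/- Let T be an invertible ergodic measure-preserving transformation of a Lebesgue probability space (X, S, μ), and let C ⊆ S be a family of measurable sets with H_μ(C) > 0. Then there exists a dense G_δ set G ⊂ Φ such that for each φ ∈ G, letting T_φ = φ^{-1} ∘ T ∘ φ, one has limsup_{n→∞} sup_{C ∈ C} ∫ |(1/n) Σ_{i=0}^{n-1} 1_C(T_φ^i x) − μ(C)| dμ(x) > 0. -/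
open MeasureTheory Filter

/-- The invertible measure preserving transformations of `(X, 𝒮, μ)` (representatives of
the equivalence classes mod 0). -/
def MPE {X : Type*} [MeasurableSpace X] (μ : Measure X) : Type _ :=
  {e : X ≃ᵐ X // MeasurePreserving e μ μ}

/-- The weak topology on the invertible measure preserving transformations:
`φ_r → φ` iff `μ (φ_r A ∆ φ A) → 0` for every measurable set `A`.  It is realized as the
topology induced by the maps `φ ↦ 1_{φ A} ∈ L¹(μ)` for measurable `A` (note that
`φ A = φ.symm ⁻¹' A`, and `‖1_{φ' A} - 1_{φ A}‖₁ = μ (φ' A ∆ φ A)`). -/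
noncomputable instance MPE.topologicalSpace {X : Type*} [MeasurableSpace X]
    {μ : Measure X} [IsFiniteMeasure μ] : TopologicalSpace (MPE μ) :=
  TopologicalSpace.induced
    (fun φ : MPE μ => fun A : {A : Set X // MeasurableSet A} =>
      (indicatorConstLp 1 (A.2.preimage φ.1.symm.measurable) (measure_ne_top μ _)
        (1 : ℝ) : Lp ℝ 1 μ))
    inferInstance

/-- The conjugate transformation `T_φ = φ⁻¹ ∘ T ∘ φ`. -/
def MPE.conj {X : Type*} [MeasurableSpace X] {μ : Measure X}
    (T : X ≃ᵐ X) (φ : MPE μ) : X → X :=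
  fun x => φ.1.symm (T (φ.1 x))

open Classical in
/-- Gibbs type bound of the entropy of a join. -/
lemma ent_bound {X : Type*} [MeasurableSpace X] (μ : Measure X) [IsProbabilityMeasure μ]
    {m n : ℕ} (w : X → (Fin m → Bool)) (hw : Measurable w) (C : Fin n → Set X)
    (hC : ∀ i, MeasurableSet (C i)) (d : Fin n → (Fin m → Bool) → Bool) (ε : ℝ) (h0 : 0 < ε)
    (h1 : ε < 1) (hd : ∀ i, μ.real {x | decide (x ∈ C i) ≠ d i (w x)} ≤ ε) :
    joinEntropy μ C * Real.log 2 ≤ m * Real.log 2 + n * (-Real.log (1 - ε) - ε * Real.log ε) := by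
  set g : X → (Fin n → Bool) × (Fin m → Bool) := fun x => (fun i => decide (x ∈ C i), w x) with hg
  have hgm : Measurable g := by
    refine Measurable.prodMk ?_ hw
    refine measurable_pi_lambda _ fun i => ?_
    refine measurable_to_bool ?_
    convert hC i using 1
    ext x; simp
  have hgp : ∀ z, MeasurableSet (g ⁻¹' {z}) := fun z => hgm (measurableSet_singleton z)
  set p : (Fin n → Bool) → (Fin m → Bool) → ℝ := fun s v => μ.real (g ⁻¹' {(s, v)}) with hp
  set P : (Fin n → Bool) → ℝ := fun s => μ.real (⋂ i, if s i then C i else (C i)ᶜ) with hP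
  have hsum : ∀ S : Finset ((Fin n → Bool) × (Fin m → Bool)),
      ∑ z ∈ S, p z.1 z.2 = μ.real (g ⁻¹' S) := by
    intro S
    exact sum_measureReal_preimage_singleton S (fun y _ => hgp y)
  have hPp : ∀ s, P s = ∑ v, p s v := by
    intro s
    have := hsum ({s} ×ˢ Finset.univ)
    rw [Finset.sum_product] at this
    simp only [Finset.sum_singleton] at this
    rw [this]
    simp only [hP]
    congr 1
    ext x
    simp only [Set.mem_iInter, Set.mem_preimage, hg, Finset.coe_product, Finset.coe_singleton,
      Finset.coe_univ, Set.mem_prod, Set.mem_singleton_iff, Set.mem_univ, and_true, funext_iff]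
    refine forall_congr' fun i => ?_
    cases h : s i <;> simp
  have hptot : ∑ s, ∑ v, p s v = 1 := by
    rw [← Fintype.sum_prod_type' (f := p), hsum]
    simp
  have hpn : ∀ s v, 0 ≤ p s v := fun s v => measureReal_nonneg
  set c : Bool → ℝ := fun b => if b then 1 - ε else ε with hc
  have hcpos : ∀ b, 0 < c b := by intro b; cases b <;> simp [hc]; exacts [h0, h1]
  set q : (Fin n → Bool) → ℝ := fun s =>
    (2 ^ m : ℝ)⁻¹ * ∑ v : Fin m → Bool, ∏ i, c (decide (s i = d i v)) with hq
  have hqsum : ∑ s, q s = 1 := by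
    simp only [hq]
    rw [← Finset.mul_sum, Finset.sum_comm]
    have : ∀ v : Fin m → Bool, ∑ s : Fin n → Bool, ∏ i, c (decide (s i = d i v)) = 1 := by
      intro v
      have := Finset.prod_univ_sum (fun _ : Fin n => (Finset.univ : Finset Bool))
        (fun i b => c (decide (b = d i v)))
      rw [Fintype.piFinset_univ] at this
      rw [← this]
      refine Finset.prod_eq_one fun i _ => ?_
      cases d i v <;> simp [hc]
    simp [this]
  have hqge : ∀ s v, (2 ^ m : ℝ)⁻¹ * ∏ i, c (decide (s i = d i v)) ≤ q s := by
    intro s v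
    simp only [hq]
    refine mul_le_mul_of_nonneg_left ?_ (by positivity)
    exact Finset.single_le_sum (f := fun v => ∏ i, c (decide (s i = d i v)))
      (fun v _ => Finset.prod_nonneg fun i _ => (hcpos _).le) (Finset.mem_univ v)
  have hprodpos : ∀ (s : Fin n → Bool) (v : Fin m → Bool), 0 < (2 ^ m : ℝ)⁻¹ * ∏ i, c (decide (s i = d i v)) := by
    intro s v
    have := Finset.prod_pos (s := Finset.univ) (f := fun i => c (decide (s i = d i v)))
      (fun i _ => hcpos _)
    positivity
  have hqpos : ∀ s, 0 < q s := fun s => (hprodpos s (fun _ => true)).trans_le (hqge s _)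
  have hgibbs : ∀ s, -(P s * Real.log (P s)) ≤ P s * (-Real.log (q s)) + (q s - P s) := by
    intro s
    have hPn : 0 ≤ P s := measureReal_nonneg
    rcases hPn.eq_or_lt with h | h
    · rw [← h]; simp; exact (hqpos s).le
    · have := Real.log_le_sub_one_of_pos (div_pos (hqpos s) h)
      rw [Real.log_div (hqpos s).ne' h.ne'] at this
      have h2 := mul_le_mul_of_nonneg_left this hPn
      have h3 : P s * (q s / P s - 1) = q s - P s := by field_simp
      rw [h3] at h2
      linarith
  have hlog : ∀ s v, -Real.log (q s) ≤ m * Real.log 2 + (n * (-Real.log (1 - ε)) +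
      ∑ i, (if s i = d i v then 0 else -Real.log ε)) := by
    intro s v
    have h := Real.log_le_log (hprodpos s v) (hqge s v)
    rw [Real.log_mul (by positivity) (Finset.prod_pos fun i _ => hcpos _).ne', Real.log_inv,
      Real.log_pow, Real.log_prod (fun i _ => (hcpos _).ne')] at h
    have h2 : ∑ i, -Real.log (c (decide (s i = d i v))) ≤ n * (-Real.log (1 - ε)) +
      ∑ i, (if s i = d i v then 0 else -Real.log ε) := by
      have : (n : ℝ) * (-Real.log (1 - ε)) = ∑ i : Fin n, (-Real.log (1 - ε)) := by simp
      rw [this, ← Finset.sum_add_distrib]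
      refine Finset.sum_le_sum fun i _ => ?_
      by_cases hh : s i = d i v
      · simp [hh, hc]
      · simp [hh, hc]
        exact Real.log_nonpos (by linarith) (by linarith)
    rw [Finset.sum_neg_distrib] at h2
    linarith
  have hJ : joinEntropy μ C * Real.log 2 = ∑ s, -(P s * Real.log (P s)) := by
    unfold joinEntropy
    rw [Finset.sum_mul]
    refine Finset.sum_congr rfl fun s _ => ?_
    simp only [hP, Measure.real, Real.logb]
    have : Real.log 2 ≠ 0 := by positivity
    field_simp
  rw [hJ]
  calc ∑ s, -(P s * Real.log (P s)) ≤ ∑ s, (P s * (-Real.log (q s)) + (q s - P s)) :=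
        Finset.sum_le_sum fun s _ => hgibbs s
    _ = ∑ s, P s * (-Real.log (q s)) := by
        rw [Finset.sum_add_distrib, Finset.sum_sub_distrib, hqsum]
        simp only [hPp, hptot]; simp
    _ ≤ ∑ s, ∑ v, p s v * (m * Real.log 2 + (n * (-Real.log (1 - ε)) +
      ∑ i, (if s i = d i v then 0 else -Real.log ε))) := by
        refine Finset.sum_le_sum fun s _ => ?_
        rw [hPp, Finset.sum_mul]
        exact Finset.sum_le_sum fun v _ => mul_le_mul_of_nonneg_left (hlog s v) (hpn s v)
    _ = (m * Real.log 2 + n * (-Real.log (1 - ε))) +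
        ∑ i, (-Real.log ε) * ∑ s, ∑ v, (if s i = d i v then 0 else p s v) := by
        have e1 : ∀ s v, p s v * (m * Real.log 2 + (n * (-Real.log (1 - ε)) +
          ∑ i, (if s i = d i v then 0 else -Real.log ε))) =
          p s v * (m * Real.log 2 + n * (-Real.log (1 - ε))) +
          ∑ i, (-Real.log ε) * (if s i = d i v then 0 else p s v) := by
          intro s v
          rw [← add_assoc, mul_add, Finset.mul_sum]
          congr 1
          refine Finset.sum_congr rfl fun i _ => ?_
          split_ifs <;> ring
        simp only [e1, Finset.sum_add_distrib, ← Finset.sum_mul, hptot, one_mul]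
        congr 1
        rw [Finset.sum_congr rfl fun s _ => Finset.sum_comm, Finset.sum_comm]
        refine Finset.sum_congr rfl fun i _ => ?_
        simp only [Finset.mul_sum]
    _ ≤ (m * Real.log 2 + n * (-Real.log (1 - ε))) + ∑ i : Fin n, (-Real.log ε) * ε := by
        gcongr with i
        · have := Real.log_nonpos h0.le h1.le
          linarith
        · refine le_trans (le_of_eq ?_) (hd i)
          have := hsum (Finset.univ.filter fun z => z.1 i ≠ d i z.2)
          rw [Finset.sum_filter, Fintype.sum_prod_type] at this
          convert this using 1
          · refine Finset.sum_congr rfl fun s _ => Finset.sum_congr rfl fun v _ => ?_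
            simp only [ne_eq, ite_not]
          · congr 1; ext x; simp [hg]
    _ = _ := by simp; ring

open Classical in
lemma famEntropy_nonpos {X : Type*} [MeasurableSpace X] (μ : Measure X) [IsProbabilityMeasure μ]
    (𝒞 : Set (Set X)) (h𝒞 : ∀ C ∈ 𝒞, MeasurableSet C)
    (H : ∀ ε : ℝ, 0 < ε → ∃ (m : ℕ) (w : X → (Fin m → Bool)), Measurable w ∧ ∀ C ∈ 𝒞,
      ∃ d : (Fin m → Bool) → Bool, μ.real {x | decide (x ∈ C) ≠ d (w x)} ≤ ε) :
    famEntropy μ 𝒞 ≤ 0 := by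
  by_contra hcon
  push Not at hcon
  unfold famEntropy at hcon
  have hne : Nonempty {f : ℕ → Set X // ∀ i, f i ∈ 𝒞} := by
    by_contra hh
    rw [not_nonempty_iff] at hh
    rw [Real.iSup_of_isEmpty] at hcon
    exact lt_irrefl _ hcon
  obtain ⟨⟨S, hS⟩, hlim⟩ := exists_lt_of_lt_ciSup hcon
  rw [liminf_eq] at hlim
  have hne2 : {a : ℝ | ∀ᶠ n : ℕ in atTop,
      a ≤ joinEntropy μ (fun i : Fin n => S i) / n}.Nonempty := by
    by_contra hh
    rw [Set.not_nonempty_iff_eq_empty] at hh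
    simp only at hlim
    rw [hh, Real.sSup_empty] at hlim
    exact lt_irrefl _ hlim
  obtain ⟨a, ha, ha0⟩ := exists_lt_of_lt_csSup hne2 hlim
  -- choose ε
  have ht : Tendsto (fun ε : ℝ => -Real.log (1 - ε) - ε * Real.log ε) (nhds 0) (nhds 0) := by
    have h1 : Continuous (fun ε : ℝ => ε * Real.log ε) := Real.continuous_mul_log
    have h2 : ContinuousAt (fun ε : ℝ => -Real.log (1 - ε)) 0 := by
      refine ContinuousAt.neg (ContinuousAt.log (by fun_prop) (by norm_num))
    have := (h2.sub h1.continuousAt)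
    simp only [ContinuousAt, Pi.sub_apply, sub_zero, Real.log_one, neg_zero, zero_mul] at this
    exact this
  have hl2 : 0 < Real.log 2 := Real.log_pos (by norm_num)
  have hpos : 0 < a * Real.log 2 / 2 := by positivity
  have h3 := (ht.eventually (gt_mem_nhds hpos))
  have h4 : ∀ᶠ ε : ℝ in nhdsWithin 0 (Set.Ioi 0), (0 < ε ∧ ε < 1) ∧
      -Real.log (1 - ε) - ε * Real.log ε < a * Real.log 2 / 2 := by
    refine Eventually.and ?_ (h3.filter_mono nhdsWithin_le_nhds)
    exact Ioo_mem_nhdsGT (by norm_num)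
  obtain ⟨ε, ⟨hε0, hε1⟩, hε⟩ := h4.exists
  obtain ⟨m, w, hw, hd⟩ := H ε hε0
  choose! d hd using hd
  have key : ∀ n : ℕ, joinEntropy μ (fun i : Fin n => S i) * Real.log 2 ≤ m * Real.log 2 +
      n * (-Real.log (1 - ε) - ε * Real.log ε) := fun n =>
    ent_bound μ w hw (fun i : Fin n => S i) (fun i => h𝒞 _ (hS i)) (fun i => d (S i)) ε hε0 hε1
      (fun i => hd _ (hS i))
  obtain ⟨N, hN⟩ := exists_nat_gt (2 * m / a)
  obtain ⟨n, hn1, hn2⟩ := (ha.and (eventually_ge_atTop (N + 1))).exists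
  have hnpos : (0 : ℝ) < n := by exact_mod_cast (by omega : 0 < n)
  rw [le_div_iff₀ hnpos] at hn1
  have hnN : (N : ℝ) + 1 ≤ n := by exact_mod_cast hn2
  have k := key n
  have k2 : a * n * Real.log 2 ≤ m * Real.log 2 + n * (a * Real.log 2 / 2) := by
    calc a * n * Real.log 2 ≤ _ := mul_le_mul_of_nonneg_right hn1 hl2.le
      _ ≤ _ := k
      _ ≤ _ := by gcongr
  have k3 : a * n ≤ 2 * m := by
    by_contra hh
    push Not at hh
    nlinarith
  rw [div_lt_iff₀ ha0] at hN
  nlinarith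


section ErgPart
variable {X : Type*} [MeasurableSpace X] {μ : Measure X} [IsProbabilityMeasure μ]

lemma symmDiff_iterate_le {S : X → X} (hS : MeasurePreserving S μ μ) {E : Set X}
    (hE : MeasurableSet E) {δ : ℝ} (hδ : μ.real (symmDiff (S ⁻¹' E) E) ≤ δ) (i : ℕ) :
    μ.real (symmDiff (S^[i] ⁻¹' E) E) ≤ i * δ := by
  induction i with
  | zero => simp
  | succ i ih =>
    have h1 : symmDiff (S^[i+1] ⁻¹' E) E ⊆
        S^[i] ⁻¹' (symmDiff (S ⁻¹' E) E) ∪ symmDiff (S^[i] ⁻¹' E) E := by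
      have : S^[i+1] ⁻¹' E = S^[i] ⁻¹' (S ⁻¹' E) := by
        rw [Function.iterate_succ', Set.preimage_comp]
      rw [this, Set.preimage_symmDiff]
      exact symmDiff_triangle _ _ _
    calc _ ≤ _ := measureReal_mono h1
      _ ≤ _ := measureReal_union_le _ _
      _ ≤ δ + i * δ := by
        refine add_le_add ?_ ih
        rw [(hS.iterate i).measureReal_preimage
          (((hS.measurable hE).symmDiff hE).nullMeasurableSet)]
        exact hδ
      _ = _ := by push_cast; ring

lemma birkDev_ge {S : X → X} (hS : MeasurePreserving S μ μ) {E C : Set X}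
    (hE : MeasurableSet E) (hC : MeasurableSet C) {δ : ℝ}
    (hδ : μ.real (symmDiff (S ⁻¹' E) E) ≤ δ) {n : ℕ} (hn : 0 < n) :
    |μ.real (E ∩ C) - μ.real E * μ.real C| - n * δ ≤ birkDev μ S C n := by
  have hδ0 : 0 ≤ δ := measureReal_nonneg.trans hδ
  have hn' : (0 : ℝ) < n := by exact_mod_cast hn
  set F : X → ℝ := fun x =>
    (∑ i ∈ Finset.range n, C.indicator (fun _ => (1 : ℝ)) (S^[i] x)) / n - (μ C).toReal with hF
  have hint : ∀ i, Integrable (fun x => C.indicator (fun _ => (1 : ℝ)) (S^[i] x)) μ := by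
    intro i
    have : (fun x => C.indicator (fun _ => (1 : ℝ)) (S^[i] x)) =
        (S^[i] ⁻¹' C).indicator (fun _ => (1 : ℝ)) := by
      ext x; rfl
    rw [this]
    exact (integrable_const _).indicator ((hS.iterate i).measurable hC)
  have hFint : Integrable F μ :=
    ((integrable_finsetSum _ fun i _ => hint i).div_const _).sub (integrable_const _)
  have h1 : ∫ x in E, F x ∂μ =
      (∑ i ∈ Finset.range n, μ.real (E ∩ S^[i] ⁻¹' C)) / n - μ.real E * μ.real C := by
    simp only [hF]
    rw [integral_sub, integral_div, integral_finsetSum]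
    · congr 1
      · congr 1
        refine Finset.sum_congr rfl fun i _ => ?_
        have : (fun x => C.indicator (fun _ => (1 : ℝ)) (S^[i] x)) =
          (S^[i] ⁻¹' C).indicator 1 := by
          ext x; rfl
        rw [this, integral_indicator_one ((hS.iterate i).measurable hC)]
        rw [measureReal_restrict_apply ((hS.iterate i).measurable hC), Set.inter_comm]
      · simp [Measure.real]
    · exact fun i _ => (hint i).integrableOn
    · exact ((integrable_finsetSum _ fun i _ => hint i).div_const _).integrableOn
    · exact (integrable_const _)
  have h2 : |∫ x in E, F x ∂μ| ≤ birkDev μ S C n := by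
    calc |∫ x in E, F x ∂μ| ≤ ∫ x in E, |F x| ∂μ := abs_integral_le_integral_abs
      _ ≤ ∫ x, |F x| ∂μ := setIntegral_le_integral hFint.abs
          (Eventually.of_forall fun x => abs_nonneg _)
      _ = _ := rfl
  have h3 : |(∑ i ∈ Finset.range n, μ.real (E ∩ S^[i] ⁻¹' C)) / n - μ.real (E ∩ C)| ≤ n * δ := by
    have : (∑ i ∈ Finset.range n, μ.real (E ∩ S^[i] ⁻¹' C)) / n - μ.real (E ∩ C) =
      (∑ i ∈ Finset.range n, (μ.real (E ∩ S^[i] ⁻¹' C) - μ.real (E ∩ C))) / n := by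
      rw [Finset.sum_sub_distrib]; simp; field_simp
    rw [this, abs_div, abs_of_pos hn', div_le_iff₀ hn']
    refine (Finset.abs_sum_le_sum_abs _ _).trans ?_
    have : n * δ * n = ∑ i ∈ Finset.range n, n * δ := by simp; ring
    rw [this]
    refine Finset.sum_le_sum fun i hi => ?_
    have hin : (i : ℝ) ≤ n := by exact_mod_cast (Finset.mem_range.1 hi).le
    have e1 : μ.real (E ∩ C) = μ.real (S^[i] ⁻¹' (E ∩ C)) :=
      ((hS.iterate i).measureReal_preimage (hE.inter hC).nullMeasurableSet).symm
    have hmi := (hS.iterate i).measurable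
    rw [e1]
    calc _ ≤ _ := abs_measureReal_sub_le_measureReal_symmDiff
          (hE.inter (hmi hC)).nullMeasurableSet (hmi (hE.inter hC)).nullMeasurableSet
      _ ≤ μ.real (symmDiff (S^[i] ⁻¹' E) E) := by
        refine measureReal_mono ?_
        intro x
        simp only [Set.mem_symmDiff, Set.mem_inter_iff, Set.mem_preimage]
        tauto
      _ ≤ i * δ := symmDiff_iterate_le hS hE hδ i
      _ ≤ _ := by gcongr
  rw [h1] at h2
  have h4 := abs_sub_abs_le_abs_sub (μ.real (E ∩ C) - μ.real E * μ.real C)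
    ((∑ i ∈ Finset.range n, μ.real (E ∩ S^[i] ⁻¹' C)) / n - μ.real E * μ.real C)
  have h5 : (μ.real (E ∩ C) - μ.real E * μ.real C) -
    ((∑ i ∈ Finset.range n, μ.real (E ∩ S^[i] ⁻¹' C)) / n - μ.real E * μ.real C) =
    -((∑ i ∈ Finset.range n, μ.real (E ∩ S^[i] ⁻¹' C)) / n - μ.real (E ∩ C)) := by ring
  rw [h5, abs_neg] at h4
  linarith

lemma coeFn_avg {S : X → X} (hS : MeasurePreserving S μ μ) {C : Set X}
    (hC : MeasurableSet C) (p : ENNReal) [Fact (1 ≤ p)] (n : ℕ) :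
    ((n : ℝ)⁻¹ • ∑ i ∈ Finset.range n, indicatorConstLp p ((hS.iterate i).measurable hC)
      (measure_ne_top μ _) (1 : ℝ) : Lp ℝ p μ) =ᵐ[μ] fun x =>
      (∑ i ∈ Finset.range n, C.indicator (fun _ => (1 : ℝ)) (S^[i] x)) / n := by
  have h : ∀ k : ℕ, (∑ i ∈ Finset.range k, indicatorConstLp p ((hS.iterate i).measurable hC)
      (measure_ne_top μ _) (1 : ℝ) : Lp ℝ p μ) =ᵐ[μ] fun x =>
      ∑ i ∈ Finset.range k, C.indicator (fun _ => (1 : ℝ)) (S^[i] x) := by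
    intro k
    induction k with
    | zero => simp only [Finset.range_zero, Finset.sum_empty]; exact Lp.coeFn_zero ℝ p μ
    | succ k ih =>
      rw [Finset.sum_range_succ]
      filter_upwards [ih, Lp.coeFn_add (∑ i ∈ Finset.range k, indicatorConstLp p
        ((hS.iterate i).measurable hC) (measure_ne_top μ _) (1 : ℝ) : Lp ℝ p μ)
        (indicatorConstLp p ((hS.iterate k).measurable hC) (measure_ne_top μ _) (1 : ℝ)),
        indicatorConstLp_coeFn (p := p) (hs := (hS.iterate k).measurable hC)
          (hμs := measure_ne_top μ _) (c := (1 : ℝ))] with x h1 h2 h3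
      rw [h2, Pi.add_apply, h1, h3, Finset.sum_range_succ]
      rfl
  filter_upwards [h n, Lp.coeFn_smul (n : ℝ)⁻¹ (∑ i ∈ Finset.range n, indicatorConstLp p
    ((hS.iterate i).measurable hC) (measure_ne_top μ _) (1 : ℝ) : Lp ℝ p μ)] with x h1 h2
  rw [h2, Pi.smul_apply, h1, smul_eq_mul, div_eq_inv_mul]

lemma coeFn_avg_sub {S : X → X} (hS : MeasurePreserving S μ μ) {C : Set X}
    (hC : MeasurableSet C) (p : ENNReal) [Fact (1 ≤ p)] (n : ℕ) (c : ℝ) :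
    ((n : ℝ)⁻¹ • ∑ i ∈ Finset.range n, indicatorConstLp p ((hS.iterate i).measurable hC)
      (measure_ne_top μ _) (1 : ℝ) -
      indicatorConstLp p MeasurableSet.univ (measure_ne_top μ _) c : Lp ℝ p μ) =ᵐ[μ] fun x =>
      (∑ i ∈ Finset.range n, C.indicator (fun _ => (1 : ℝ)) (S^[i] x)) / n - c := by
  filter_upwards [coeFn_avg hS hC p n, Lp.coeFn_sub ((n : ℝ)⁻¹ • ∑ i ∈ Finset.range n,
    indicatorConstLp p ((hS.iterate i).measurable hC) (measure_ne_top μ _) (1 : ℝ))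
    (indicatorConstLp p MeasurableSet.univ (measure_ne_top μ _) c),
    indicatorConstLp_coeFn (p := p) (hs := MeasurableSet.univ)
          (hμs := measure_ne_top μ _) (c := c)] with x h1 h2 h3
  rw [h2, Pi.sub_apply, h1, h3]
  simp

lemma birkDev_eq_norm {S : X → X} (hS : MeasurePreserving S μ μ) {C : Set X}
    (hC : MeasurableSet C) (n : ℕ) :
    birkDev μ S C n = ‖((n : ℝ)⁻¹ • ∑ i ∈ Finset.range n,
      indicatorConstLp 1 ((hS.iterate i).measurable hC)
      (measure_ne_top μ _) (1 : ℝ) -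
      indicatorConstLp 1 MeasurableSet.univ (measure_ne_top μ _) (μ C).toReal : Lp ℝ 1 μ)‖ := by
  rw [L1.norm_eq_integral_norm]
  unfold birkDev
  refine integral_congr_ae ?_
  filter_upwards [coeFn_avg_sub hS hC 1 n (μ C).toReal] with x hx
  rw [hx]; rfl

lemma birkDev_le_norm {S : X → X} (hS : MeasurePreserving S μ μ) {C : Set X}
    (hC : MeasurableSet C) (n : ℕ) :
    birkDev μ S C n ≤ ‖((n : ℝ)⁻¹ • ∑ i ∈ Finset.range n,
      indicatorConstLp 2 ((hS.iterate i).measurable hC)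
      (measure_ne_top μ _) (1 : ℝ) -
      indicatorConstLp 2 MeasurableSet.univ (measure_ne_top μ _) (μ C).toReal : Lp ℝ 2 μ)‖ := by
  rw [birkDev_eq_norm hS hC, Lp.norm_def, Lp.norm_def,
    eLpNorm_congr_ae (coeFn_avg_sub hS hC 1 n (μ C).toReal),
    ← eLpNorm_congr_ae (coeFn_avg_sub hS hC 2 n (μ C).toReal)]
  refine ENNReal.toReal_mono (Lp.eLpNorm_ne_top _) ?_
  exact eLpNorm_le_eLpNorm_of_exponent_le (by norm_num) (Lp.aestronglyMeasurable _)

/-- Mean ergodic theorem. -/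
lemma birkDev_tendsto {T : X → X} (hT : Ergodic T μ) {C : Set X} (hC : MeasurableSet C) :
    Tendsto (fun n => birkDev μ T C n) atTop (nhds 0) := by
  have hS := hT.toMeasurePreserving
  set U : Lp ℝ 2 μ →L[ℝ] Lp ℝ 2 μ :=
    (Lp.compMeasurePreservingₗᵢ ℝ T hS).toContinuousLinearMap with hU
  have hUapp : ∀ f, U f = Lp.compMeasurePreserving T hS f := fun f => rfl
  set f : Lp ℝ 2 μ := indicatorConstLp 2 hC (measure_ne_top μ _) (1 : ℝ) with hf
  have key := ContinuousLinearMap.tendsto_birkhoffAverage_orthogonalProjection U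
    (LinearIsometry.norm_toContinuousLinearMap_le _) f
  set K := ((U : Lp ℝ 2 μ →ₗ[ℝ] Lp ℝ 2 μ).eqLocus
    ((1 : Lp ℝ 2 μ →L[ℝ] Lp ℝ 2 μ) : Lp ℝ 2 μ →ₗ[ℝ] Lp ℝ 2 μ)) with hK
  set y : Lp ℝ 2 μ := (K.orthogonalProjectionOnto f : Lp ℝ 2 μ) with hy
  have hyK : U y = y := by
    have : y ∈ K := (K.orthogonalProjectionOnto f).2
    rw [hK, LinearMap.mem_eqLocus] at this
    simpa using this
  have hyc : ∃ c : ℝ, y =ᵐ[μ] Function.const X c := by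
    refine hT.ae_eq_const_of_ae_eq_comp_ae (Lp.aestronglyMeasurable y) ?_
    have := Lp.coeFn_compMeasurePreserving y hS
    rw [← hUapp, hyK] at this
    exact this.symm
  obtain ⟨c, hc⟩ := hyc
  set one : Lp ℝ 2 μ := indicatorConstLp 2 MeasurableSet.univ (measure_ne_top μ _) (1 : ℝ) with hone
  have hone_mem : one ∈ K := by
    rw [hK, LinearMap.mem_eqLocus]
    change U one = one
    rw [hUapp, hone, Lp.indicatorConstLp_compMeasurePreserving]
    rfl
  have hin : inner ℝ (f - y) one = 0 := Submodule.starProjection_inner_eq_zero f one hone_mem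
  have hcC : c = (μ C).toReal := by
    rw [inner_sub_left, sub_eq_zero, real_inner_comm, real_inner_comm one y,
      L2.inner_indicatorConstLp_one, L2.inner_indicatorConstLp_one] at hin
    simp only [Measure.restrict_univ] at hin
    rw [integral_congr_ae hc] at hin
    have h2 : ∫ x, f x ∂μ = μ.real C := by
      rw [← integral_indicator_one hC]
      refine integral_congr_ae ?_
      filter_upwards [indicatorConstLp_coeFn (p := 2) (hs := hC)
          (hμs := measure_ne_top μ _) (c := (1 : ℝ))] with x hx
      rw [hf, hx]; rfl
    rw [h2] at hin
    simp at hin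
    exact hin.symm
  have hyeq : y = indicatorConstLp 2 MeasurableSet.univ (measure_ne_top μ _) (μ C).toReal := by
    refine Lp.ext ?_
    filter_upwards [hc, indicatorConstLp_coeFn (p := 2) (hs := MeasurableSet.univ)
          (hμs := measure_ne_top μ _) (c := (μ C).toReal)] with x h1 h2
    rw [h1, h2, hcC]; simp
  have hiter : ∀ i, U^[i] f = indicatorConstLp 2 ((hS.iterate i).measurable hC)
      (measure_ne_top μ _) (1 : ℝ) := by
    intro i
    induction i with
    | zero => rfl
    | succ i ih =>
      rw [Function.iterate_succ_apply', ih, hUapp, Lp.indicatorConstLp_compMeasurePreserving]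
      rfl
  have hba : ∀ n, birkhoffAverage ℝ U id n f = (n : ℝ)⁻¹ • ∑ i ∈ Finset.range n,
      indicatorConstLp 2 ((hS.iterate i).measurable hC) (measure_ne_top μ _) (1 : ℝ) := by
    intro n
    simp only [birkhoffAverage, birkhoffSum, id, hiter]
  have h0 := tendsto_iff_norm_sub_tendsto_zero.1 key
  refine squeeze_zero (fun n => ?_) (fun n => ?_) h0
  · exact integral_nonneg fun x => abs_nonneg _
  · refine (birkDev_le_norm hS hC n).trans (le_of_eq ?_)
    rw [hba]
    congr 2
    exact hyeq.symm

lemma exists_almost_inv {T : X → X} (hT : Ergodic T μ) {B : Set X} (hB : MeasurableSet B)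
    (hB0 : 0 < μ.real B) :
    ∃ E, MeasurableSet E ∧ |μ.real E - 1 / 2| ≤ μ.real B ∧
      μ.real (symmDiff (T ⁻¹' E) E) ≤ 2 * μ.real B := by
  have hS := hT.toMeasurePreserving
  have hpm : ∀ i, MeasurableSet (T^[i] ⁻¹' B) := fun i => (hS.iterate i).measurable hB
  have hpB : ∀ i, μ.real (T^[i] ⁻¹' B) = μ.real B := fun i =>
    (hS.iterate i).measureReal_preimage hB.nullMeasurableSet
  set E : ℕ → Set X := fun m => ⋃ i, ⋃ (_ : i < m), T^[i] ⁻¹' B with hEdef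
  have hEm : ∀ m, MeasurableSet (E m) := fun m =>
    MeasurableSet.iUnion fun i => MeasurableSet.iUnion fun _ => hpm i
  have hmono : Monotone E := by
    intro a b hab
    exact Set.biUnion_subset_biUnion_left fun i (hi : i < a) => lt_of_lt_of_le hi hab
  have hU : (⋃ m, E m) = ⋃ i, T^[i] ⁻¹' B := by
    ext x
    simp only [hEdef, Set.mem_iUnion, exists_prop]
    constructor
    · rintro ⟨m, i, _, h⟩; exact ⟨i, h⟩
    · rintro ⟨i, h⟩; exact ⟨i + 1, i, Nat.lt_succ_self i, h⟩
  have hinv : T ⁻¹' (⋃ m, E m) ⊆ ⋃ m, E m := by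
    rw [hU]
    intro x hx
    simp only [Set.mem_preimage, Set.mem_iUnion] at hx ⊢
    obtain ⟨i, hi⟩ := hx
    exact ⟨i + 1, by rwa [Function.iterate_succ_apply]⟩
  have hUm : MeasurableSet (⋃ m, E m) := MeasurableSet.iUnion hEm
  have hone : μ (⋃ m, E m) = 1 := by
    rcases hT.ae_empty_or_univ_of_preimage_ae_le hUm.nullMeasurableSet
      (Eventually.of_forall hinv) with h | h
    · exfalso
      have h1 : μ (⋃ m, E m) = 0 := by rw [measure_congr h]; simp
      have h2 : B ⊆ ⋃ m, E m := by
        rw [hU]; exact Set.subset_iUnion (fun i => T^[i] ⁻¹' B) 0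
      have h3 := measure_mono_null h2 h1
      simp [Measure.real, h3] at hB0
    · rw [measure_congr h]; simp
  have ht : Tendsto (fun m => μ.real (E m)) atTop (nhds 1) := by
    have := tendsto_measure_iUnion_atTop (μ := μ) hmono
    rw [hone] at this
    exact (ENNReal.tendsto_toReal (by simp)).comp this
  have hex : ∃ m, 1 / 2 ≤ μ.real (E m) := by
    obtain ⟨m, hm⟩ := (ht.eventually (lt_mem_nhds (show (1 / 2 : ℝ) < 1 by norm_num))).exists
    exact ⟨m, hm.le⟩
  classical
  have hfind := Nat.find_spec hex
  have hmin := fun k => Nat.find_min hex (m := k)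
  set m := Nat.find hex
  have hm0 : m ≠ 0 := by
    intro h
    rw [h] at hfind
    simp [hEdef] at hfind
    norm_num at hfind
  obtain ⟨k, hk⟩ := Nat.exists_eq_succ_of_ne_zero hm0
  have hEsucc : E m ⊆ E k ∪ T^[k] ⁻¹' B := by
    intro x hx
    simp only [hEdef, Set.mem_iUnion, exists_prop, Set.mem_union] at hx ⊢
    obtain ⟨i, hi, h⟩ := hx
    rcases Nat.lt_succ_iff_lt_or_eq.1 (hk ▸ hi) with h1 | h1
    · exact Or.inl ⟨i, h1, h⟩
    · exact Or.inr (h1 ▸ h)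
  refine ⟨E m, hEm m, ?_, ?_⟩
  · have h1 : μ.real (E m) ≤ μ.real (E k) + μ.real B := by
      calc _ ≤ _ := measureReal_mono hEsucc
        _ ≤ _ := measureReal_union_le _ _
        _ = _ := by rw [hpB]
    have h2 := hmin k (by omega)
    push Not at h2
    rw [abs_of_nonneg (by linarith)]
    linarith
  · have : symmDiff (T ⁻¹' E m) (E m) ⊆ T^[m] ⁻¹' B ∪ B := by
      intro x
      simp only [Set.mem_symmDiff, hEdef, Set.mem_iUnion, exists_prop, Set.mem_preimage,
        Set.mem_union]
      rintro (⟨⟨i, hi, h⟩, h2⟩ | ⟨⟨i, hi, h⟩, h2⟩)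
      · left
        rw [← Function.iterate_succ_apply] at h
        by_cases hh : i + 1 < m
        · exact absurd ⟨i + 1, hh, h⟩ h2
        · have : i.succ = m := by omega
          rwa [this] at h
      · right
        cases i with
        | zero => exact h
        | succ i =>
          exact absurd ⟨i, by omega, by rwa [Function.iterate_succ_apply] at h⟩ h2
    calc _ ≤ _ := measureReal_mono this
      _ ≤ _ := measureReal_union_le _ _
      _ = _ := by rw [hpB]; ring

lemma exists_almost_inv_indep {T : X → X} (hT : Ergodic T μ)
    (hB : ∀ δ : ℝ, 0 < δ → ∃ B, MeasurableSet B ∧ 0 < μ.real B ∧ μ.real B ≤ δ)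
    {ι : Type*} [Finite ι] (P : ι → Set X) (hP : ∀ j, MeasurableSet (P j)) {η δ : ℝ}
    (hη : 0 < η) (hδ : 0 < δ) :
    ∃ E, MeasurableSet E ∧ μ.real (symmDiff (T ⁻¹' E) E) ≤ δ ∧
      ∀ j, |μ.real (E ∩ P j) - 1 / 2 * μ.real (P j)| ≤ η := by
  have h1 : ∀ᶠ n in atTop, ∀ j, birkDev μ T (P j) n < η / 4 := by
    rw [eventually_all]
    intro j
    exact (birkDev_tendsto hT (hP j)).eventually (gt_mem_nhds (by positivity))
  obtain ⟨L, hL, hL0⟩ := (h1.and (eventually_gt_atTop 0)).exists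
  have hL' : (0 : ℝ) < L := by exact_mod_cast hL0
  obtain ⟨B, hBm, hB0, hBle⟩ := hB (min (δ / 2) (min (η / 4) (η / (8 * L)))) (by positivity)
  obtain ⟨E, hE, hE1, hE2⟩ := exists_almost_inv hT hBm hB0
  have b1 : μ.real B ≤ δ / 2 := hBle.trans (min_le_left _ _)
  have b2 : μ.real B ≤ η / 4 := hBle.trans ((min_le_right _ _).trans (min_le_left _ _))
  have b3 : μ.real B ≤ η / (8 * L) := hBle.trans ((min_le_right _ _).trans (min_le_right _ _))
  refine ⟨E, hE, by linarith, fun j => ?_⟩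
  have k1 := birkDev_ge hT.toMeasurePreserving hE (hP j) hE2 hL0
  have k2 := hL j
  rw [le_div_iff₀ (by positivity)] at b3
  have k3 : |μ.real (E ∩ P j) - μ.real E * μ.real (P j)| ≤ η / 2 := by nlinarith
  have k4 : |μ.real E * μ.real (P j) - 1 / 2 * μ.real (P j)| ≤ η / 4 := by
    rw [← sub_mul, abs_mul]
    have h5 : |μ.real (P j)| ≤ 1 := by
      rw [abs_of_nonneg measureReal_nonneg]; exact measureReal_le_one
    nlinarith [abs_nonneg (μ.real E - 1 / 2), abs_nonneg (μ.real (P j))]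
  have k5 := abs_sub_le (μ.real (E ∩ P j)) (μ.real E * μ.real (P j)) (1 / 2 * μ.real (P j))
  linarith
end ErgPart


section OmPart

/-- first `N` coordinates -/
def prr (N : ℕ) (x : ℕ → Bool) : Fin N → Bool := fun i => x i

lemma prr_eq_iff {N : ℕ} {x y : ℕ → Bool} : prr N x = prr N y ↔ ∀ i < N, x i = y i := by
  constructor
  · intro h i hi; exact congrFun h ⟨i, hi⟩
  · intro h; funext i; exact h i i.2

lemma prr_mono {N M : ℕ} (hNM : N ≤ M) {x y : ℕ → Bool} (h : prr M x = prr M y) :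
    prr N x = prr N y := by
  rw [prr_eq_iff] at h ⊢
  exact fun i hi => h i (hi.trans_le hNM)

lemma prr_surj {N : ℕ} (w : Fin N → Bool) : ∃ y, prr N y = w :=
  ⟨fun i => if h : i < N then w ⟨i, h⟩ else false, by funext i; simp [prr]⟩

lemma measurable_prr (N : ℕ) : Measurable (prr N) :=
  measurable_pi_lambda _ fun _ => measurable_pi_apply _

lemma prr_lift {N M : ℕ} (hNM : N ≤ M) (S : Set (Fin N → Bool)) :
    prr N ⁻¹' S = prr M ⁻¹' {u | (fun i : Fin N => u (Fin.castLE hNM i)) ∈ S} := rfl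

/-- the algebra of cylinder sets -/
def cyls : Set (Set (ℕ → Bool)) := {A | ∃ N S, A = prr N ⁻¹' S}

lemma cyls_pair {A B : Set (ℕ → Bool)} (hA : A ∈ cyls) (hB : B ∈ cyls) :
    ∃ N S S', A = prr N ⁻¹' S ∧ B = prr N ⁻¹' S' := by
  obtain ⟨N, S, rfl⟩ := hA
  obtain ⟨M, S', rfl⟩ := hB
  exact ⟨max N M, _, _, prr_lift (le_max_left _ _) S, prr_lift (le_max_right _ _) S'⟩

lemma cyls_ring : IsSetRing cyls where
  empty_mem := ⟨0, ∅, by simp⟩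
  union_mem := by
    intro A B hA hB
    obtain ⟨N, S, S', rfl, rfl⟩ := cyls_pair hA hB
    exact ⟨N, S ∪ S', rfl⟩
  sdiff_mem := by
    intro A B hA hB
    obtain ⟨N, S, S', rfl, rfl⟩ := cyls_pair hA hB
    exact ⟨N, S \ S', rfl⟩

lemma cyls_gen : (MeasurableSpace.pi : MeasurableSpace (ℕ → Bool)) =
    MeasurableSpace.generateFrom cyls := by
  refine le_antisymm ?_ ?_
  · refine iSup_le fun i => ?_
    rw [← measurable_iff_comap_le]
    refine @measurable_to_bool _ (MeasurableSpace.generateFrom cyls) _ ?_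
    refine MeasurableSpace.measurableSet_generateFrom ⟨i + 1, {u | u (Fin.last i) = true}, ?_⟩
    ext x; simp [prr]
  · refine MeasurableSpace.generateFrom_le ?_
    rintro _ ⟨N, S, rfl⟩
    exact measurable_prr N (Set.toFinite S).measurableSet

lemma cyls_ext (μ ν : Measure (ℕ → Bool)) [IsProbabilityMeasure μ] [IsProbabilityMeasure ν]
    (h : ∀ m, ∃ M, m ≤ M ∧ ∀ w, μ (prr M ⁻¹' {w}) = ν (prr M ⁻¹' {w})) : μ = ν := by
  refine ext_of_generate_finite cyls cyls_gen ?_ ?_ (by simp)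
  · intro A hA B hB _
    obtain ⟨N, S, S', rfl, rfl⟩ := cyls_pair hA hB
    exact ⟨N, S ∩ S', rfl⟩
  · rintro _ ⟨N, S, rfl⟩
    obtain ⟨M, hM, hw⟩ := h N
    rw [prr_lift hM]
    have key : ∀ S : Set (Fin M → Bool), ∀ κ : Measure (ℕ → Bool),
        κ (prr M ⁻¹' S) = ∑ b ∈ S.toFinite.toFinset, κ (prr M ⁻¹' {b}) := by
      intro S κ
      rw [sum_measure_preimage_singleton]
      · simp
      · intro y _; exact measurable_prr M (measurableSet_singleton y)
    rw [key, key]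
    exact Finset.sum_congr rfl fun b _ => hw b

variable {lam : Measure (ℕ → Bool)} [IsProbabilityMeasure lam]

lemma cyls_approx {A : Set (ℕ → Bool)} (hA : MeasurableSet A) {e : ℝ} (he : 0 < e) :
    ∃ N₀, ∀ N, N₀ ≤ N → ∃ K : Finset (Fin N → Bool),
      lam.real (symmDiff (prr N ⁻¹' K) A) < e := by
  obtain ⟨B, ⟨N₀, S, rfl⟩, hB⟩ := exists_measure_symmDiff_lt_of_generateFrom_isSetRing (μ := lam)
    cyls_ring ⟨{Set.univ}, by simp, by
      rw [Set.singleton_subset_iff]; exact ⟨0, Set.univ, rfl⟩, by simp⟩ cyls_gen hA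
    (ε := ENNReal.ofReal e) (by simpa using he)
  refine ⟨N₀, fun N hN => ?_⟩
  refine ⟨(Set.toFinite {u : Fin N → Bool |
    (fun i : Fin N₀ => u (Fin.castLE hN i)) ∈ S}).toFinset, ?_⟩
  rw [Set.Finite.coe_toFinset, ← prr_lift hN]
  exact (ENNReal.lt_ofReal_iff_toReal_lt (measure_ne_top _ _)).1 hB

lemma meas_cyl (hl : ∀ N w, lam.real (prr N ⁻¹' {w}) = (2 ^ N : ℝ)⁻¹) {N : ℕ}
    (K : Finset (Fin N → Bool)) : lam.real (prr N ⁻¹' K) = K.card * (2 ^ N : ℝ)⁻¹ := by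
  rw [← sum_measureReal_preimage_singleton K
    (fun y _ => measurable_prr N (measurableSet_singleton y))]
  simp [hl]

lemma mp_of_compat (hl : ∀ N w, lam.real (prr N ⁻¹' {w}) = (2 ^ N : ℝ)⁻¹)
    (θ : (ℕ → Bool) ≃ᵐ (ℕ → Bool))
    (h : ∀ m, ∃ M, m ≤ M ∧ ∀ x y, prr M x = prr M y ↔ prr M (θ x) = prr M (θ y)) :
    MeasurePreserving θ lam lam := by
  refine ⟨θ.measurable, ?_⟩
  haveI : IsProbabilityMeasure (lam.map θ) :=
    Measure.isProbabilityMeasure_map θ.measurable.aemeasurable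
  refine cyls_ext _ _ fun m => ?_
  obtain ⟨M, hM, hc⟩ := h m
  refine ⟨M, hM, fun w => ?_⟩
  rw [Measure.map_apply θ.measurable (measurable_prr M (measurableSet_singleton w))]
  obtain ⟨y, rfl⟩ := prr_surj w
  have : θ ⁻¹' (prr M ⁻¹' {prr M y}) = prr M ⁻¹' {prr M (θ.symm y)} := by
    ext x
    simp only [Set.mem_preimage, Set.mem_singleton_iff]
    rw [hc x (θ.symm y), θ.apply_symm_apply]
  rw [this]
  have h1 := hl M (prr M (θ.symm y))
  have h2 := hl M (prr M y)
  rw [← h2] at h1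
  exact (ENNReal.toReal_eq_toReal_iff' (measure_ne_top _ _) (measure_ne_top _ _)).1 h1

/-- compatibility at all levels `≥ N` -/
def Compat (θ : (ℕ → Bool) ≃ᵐ (ℕ → Bool)) (N : ℕ) : Prop :=
  ∀ M, N ≤ M → ∀ x y, prr M x = prr M y ↔ prr M (θ x) = prr M (θ y)

/-- dyadic permutation, as a function -/
def dyf {N : ℕ} (σ : Equiv.Perm (Fin N → Bool)) (x : ℕ → Bool) : ℕ → Bool :=
  fun i => if h : i < N then σ (prr N x) ⟨i, h⟩ else x i

lemma prr_dyf {N : ℕ} (σ : Equiv.Perm (Fin N → Bool)) (x : ℕ → Bool) :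
    prr N (dyf σ x) = σ (prr N x) := by
  funext i; simp [prr, dyf]

lemma dyf_dyf {N : ℕ} (σ τ : Equiv.Perm (Fin N → Bool)) (h : ∀ w, σ (τ w) = w) (x : ℕ → Bool) :
    dyf σ (dyf τ x) = x := by
  funext i
  by_cases hi : i < N
  · have : dyf σ (dyf τ x) i = σ (prr N (dyf τ x)) ⟨i, hi⟩ := by simp [dyf, hi]
    rw [this, prr_dyf, h]; rfl
  · simp [dyf, hi]

lemma measurable_dyf {N : ℕ} (σ : Equiv.Perm (Fin N → Bool)) : Measurable (dyf σ) := by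
  refine measurable_pi_lambda _ fun i => ?_
  by_cases hi : i < N
  · simp only [dyf, hi, dite_true]
    exact (measurable_of_countable (fun w : Fin N → Bool => σ w ⟨i, hi⟩)).comp (measurable_prr N)
  · simp only [dyf, hi, dite_false]
    exact measurable_pi_apply i

/-- dyadic permutation -/
def dy {N : ℕ} (σ : Equiv.Perm (Fin N → Bool)) : (ℕ → Bool) ≃ᵐ (ℕ → Bool) where
  toFun := dyf σ
  invFun := dyf σ.symm
  left_inv := dyf_dyf _ _ (by simp)
  right_inv := dyf_dyf _ _ (by simp)
  measurable_toFun := measurable_dyf σ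
  measurable_invFun := measurable_dyf σ.symm

lemma dy_compat {N : ℕ} (σ : Equiv.Perm (Fin N → Bool)) : Compat (dy σ) N := by
  have key : ∀ (σ : Equiv.Perm (Fin N → Bool)) M, N ≤ M → ∀ x y, prr M x = prr M y →
      prr M (dyf σ x) = prr M (dyf σ y) := by
    intro σ M hM x y h
    have h2 := prr_mono hM h
    rw [prr_eq_iff] at h ⊢
    intro i hi
    simp only [dyf, h2, h i hi]
  intro M hM x y
  refine ⟨key σ M hM x y, fun h => ?_⟩
  have := key σ.symm M hM _ _ h
  rwa [show dyf σ.symm (dy σ x) = x from dyf_dyf _ _ (by simp) x,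
    show dyf σ.symm (dy σ y) = y from dyf_dyf _ _ (by simp) y] at this

end OmPart


section CombPart
open Classical in
lemma exists_perm_inter {α : Type*} [Fintype α] (A B : Finset α) :
    ∃ σ : Equiv.Perm α, min A.card B.card ≤ (A.filter fun x => σ x ∈ B).card := by
  obtain ⟨A', hA', hA'c⟩ := Finset.exists_subset_card_eq (min_le_left A.card B.card)
  obtain ⟨B', hB', hB'c⟩ := Finset.exists_subset_card_eq (min_le_right A.card B.card)
  have e : {x // x ∈ A'} ≃ {x // x ∈ B'} := Fintype.equivOfCardEq (by simp [hA'c, hB'c])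
  refine ⟨e.extendSubtype, ?_⟩
  rw [← hA'c]
  refine Finset.card_le_card fun x hx => ?_
  rw [Finset.mem_filter]
  exact ⟨hA' hx, hB' (e.extendSubtype_mem x hx)⟩

open Classical in
lemma exists_perm_fiberwise {W V : Type*} [Fintype W] [Fintype V] (r : W → V)
    (K F : Finset W) :
    ∃ σ : Equiv.Perm W, (∀ x, r (σ x) = r x) ∧
      ∑ v, min (K.filter fun x => r x = v).card (F.filter fun x => r x = v).card
        ≤ (K.filter fun x => σ x ∈ F).card := by
  have h := fun v : V => exists_perm_inter (α := {x // r x = v})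
    (Finset.univ.filter fun x => x.1 ∈ K) (Finset.univ.filter fun x => x.1 ∈ F)
  choose s hs using h
  let σ : Equiv.Perm W := (Equiv.sigmaFiberEquiv r).symm.trans
    ((Equiv.sigmaCongrRight s).trans (Equiv.sigmaFiberEquiv r))
  have hσ : ∀ v (x : {x // r x = v}), σ x.1 = (s v x).1 := by
    rintro v ⟨x, rfl⟩
    rfl
  have hcard : ∀ v (p : W → Prop),
      (Finset.univ.filter fun x : {x // r x = v} => p x.1).card =
      (Finset.univ.filter fun x => p x ∧ r x = v).card := by
    intro v p
    rw [← Finset.card_map (Function.Embedding.subtype _)]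
    congr 1
    ext x
    simp
  refine ⟨σ, fun x => ?_, ?_⟩
  · rw [hσ (r x) ⟨x, rfl⟩]; exact (s (r x) ⟨x, rfl⟩).2
  · rw [Finset.card_eq_sum_card_fiberwise (f := r) (t := Finset.univ)
      (fun x _ => Finset.mem_coe.2 (Finset.mem_univ _))]
    refine Finset.sum_le_sum fun v _ => ?_
    have h1 := hs v
    have e1 : (K.filter fun x => r x = v).card =
        (Finset.univ.filter fun x : {x // r x = v} => x.1 ∈ K).card := by
      refine Eq.trans ?_ (Eq.trans (hcard v (fun x => x ∈ K)).symm ?_)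
      · congr 1; ext x; simp
      · congr
    have e2 : (F.filter fun x => r x = v).card =
        (Finset.univ.filter fun x : {x // r x = v} => x.1 ∈ F).card := by
      refine Eq.trans ?_ (Eq.trans (hcard v (fun x => x ∈ F)).symm ?_)
      · congr 1; ext x; simp
      · congr
    have e3 : ((K.filter fun x => σ x ∈ F).filter fun x => r x = v).card =
        (Finset.univ.filter fun x : {x // r x = v} => x.1 ∈ K ∧ σ x.1 ∈ F).card := by
      refine Eq.trans ?_ (Eq.trans (hcard v (fun x => x ∈ K ∧ σ x ∈ F)).symm ?_)
      · congr 1; ext x; simp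
      · congr
    refine (le_of_eq ?_).trans (h1.trans (le_of_eq ?_))
    · rw [e1, e2]
    · rw [e3]; congr 1; ext x; simp [hσ v x]
end CombPart


section BasePart
lemma min_split {a b p : ℝ} (h1 : p / 4 ≤ b) (h2 : b ≤ 3 * p / 4) (ha : 0 ≤ a) (hap : a ≤ p) :
    1 / 2 * min a (p - a) ≤ min a b + min a (p - b) - a := by
  rcases min_cases a (p - a) with h | h <;> rcases min_cases a b with h' | h' <;>
    rcases min_cases a (p - b) with h'' | h'' <;> rw [h.1, h'.1, h''.1] <;> linarith

open Classical in
lemma exists_perm_far {W V : Type*} [Fintype W] [Fintype V] (r : W → V) (K F : Finset W)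
    (hF : ∀ v, ((Finset.univ.filter fun x => r x = v).card : ℝ) / 4 ≤
        (F.filter fun x => r x = v).card ∧ ((F.filter fun x => r x = v).card : ℝ) ≤
        3 * ((Finset.univ.filter fun x => r x = v).card : ℝ) / 4) (t : ℝ) :
    ∃ σ : Equiv.Perm W, (∀ x, r (σ x) = r x) ∧
      1 / 4 * ∑ v, min ((K.filter fun x => r x = v).card : ℝ)
        (((Finset.univ.filter fun x => r x = v).card : ℝ) - (K.filter fun x => r x = v).card) ≤
      |((K.filter fun x => σ x ∈ F).card : ℝ) - t| := by
  obtain ⟨σ₁, h1, h1'⟩ := exists_perm_fiberwise r K F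
  obtain ⟨σ₂, h2, h2'⟩ := exists_perm_fiberwise r K Fᶜ
  have e1 : ∀ v, ((Fᶜ.filter fun x => r x = v).card : ℝ) =
      (Finset.univ.filter fun x => r x = v).card - (F.filter fun x => r x = v).card := by
    intro v
    have : (F.filter fun x => r x = v).card + (Fᶜ.filter fun x => r x = v).card =
        (Finset.univ.filter fun x => r x = v).card := by
      rw [← Finset.card_union_of_disjoint, ← Finset.filter_union, Finset.union_compl]
      exact Finset.disjoint_filter_filter disjoint_compl_right
    rw [← this]; push_cast; ring
  have e2 : ((K.filter fun x => σ₂ x ∈ Fᶜ).card : ℝ) =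
      K.card - (K.filter fun x => σ₂ x ∈ F).card := by
    have := Finset.card_filter_add_card_filter_not (s := K) (fun x => σ₂ x ∈ F)
    rw [← this]
    push_cast
    simp [Finset.mem_compl]
  have e3 : (K.card : ℝ) = ∑ v, ((K.filter fun x => r x = v).card : ℝ) := by
    rw [Finset.card_eq_sum_card_fiberwise (f := r) (t := Finset.univ)
      (fun x _ => Finset.mem_coe.2 (Finset.mem_univ _))]
    push_cast; rfl
  have f1 : ∑ v, min ((K.filter fun x => r x = v).card : ℝ) (F.filter fun x => r x = v).card ≤
      (K.filter fun x => σ₁ x ∈ F).card := by exact_mod_cast h1'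
  have f2 : ∑ v, min ((K.filter fun x => r x = v).card : ℝ) (Fᶜ.filter fun x => r x = v).card ≤
      (K.filter fun x => σ₂ x ∈ Fᶜ).card := by exact_mod_cast h2'
  rw [e2, e3] at f2
  have f3 : ∑ v, 1 / 2 * min ((K.filter fun x => r x = v).card : ℝ)
        (((Finset.univ.filter fun x => r x = v).card : ℝ) - (K.filter fun x => r x = v).card) ≤
      ∑ v, (min ((K.filter fun x => r x = v).card : ℝ) (F.filter fun x => r x = v).card +
        min ((K.filter fun x => r x = v).card : ℝ) (Fᶜ.filter fun x => r x = v).card -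
        (K.filter fun x => r x = v).card) := by
    refine Finset.sum_le_sum fun v _ => ?_
    rw [e1]
    refine min_split (hF v).1 (hF v).2 (by positivity) ?_
    exact_mod_cast Finset.card_le_card (Finset.filter_subset_filter _ (Finset.subset_univ _))
  rw [← Finset.mul_sum, Finset.sum_sub_distrib, Finset.sum_add_distrib] at f3
  by_contra hcon
  push Not at hcon
  have g1 := abs_lt.1 (hcon σ₁ h1)
  have g2 := abs_lt.1 (hcon σ₂ h2)
  linarith [g1.1, g1.2, g2.1, g2.2]

lemma exists_perm_far_dec {W V : Type*} [Fintype W] [Fintype V] [DecidableEq W] [DecidableEq V]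
    (r : W → V) (K F : Finset W)
    (hF : ∀ v, ((Finset.univ.filter fun x => r x = v).card : ℝ) / 4 ≤
        (F.filter fun x => r x = v).card ∧ ((F.filter fun x => r x = v).card : ℝ) ≤
        3 * ((Finset.univ.filter fun x => r x = v).card : ℝ) / 4) (t : ℝ) :
    ∃ σ : Equiv.Perm W, (∀ x, r (σ x) = r x) ∧
      1 / 4 * ∑ v, min ((K.filter fun x => r x = v).card : ℝ)
        (((Finset.univ.filter fun x => r x = v).card : ℝ) - (K.filter fun x => r x = v).card) ≤
      |((K.filter fun x => σ x ∈ F).card : ℝ) - t| := by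
  convert exists_perm_far r K F ?_ t
  convert hF
end BasePart


section BasePart2
lemma real_le_add_symmDiff {X : Type*} [MeasurableSpace X] {μ : Measure X} [IsFiniteMeasure μ]
    (A B : Set X) : μ.real A ≤ μ.real B + μ.real (symmDiff A B) := by
  refine (measureReal_mono (s₂ := B ∪ symmDiff A B) ?_).trans (measureReal_union_le _ _)
  intro x hx
  by_cases hB : x ∈ B
  · exact Or.inl hB
  · exact Or.inr (Or.inl ⟨hx, hB⟩)

lemma abs_real_sub_le {X : Type*} [MeasurableSpace X] {μ : Measure X} [IsFiniteMeasure μ]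
    (A B : Set X) : |μ.real A - μ.real B| ≤ μ.real (symmDiff A B) := by
  have h1 := real_le_add_symmDiff (μ := μ) A B
  have h2 := real_le_add_symmDiff (μ := μ) B A
  rw [symmDiff_comm] at h2
  exact abs_le.2 ⟨by linarith, by linarith⟩

lemma symmDiff_inter_sub {X : Type*} (A B A' B' : Set X) :
    symmDiff (A ∩ B) (A' ∩ B') ⊆ symmDiff A A' ∪ symmDiff B B' := by
  intro x; simp only [Set.mem_symmDiff, Set.mem_inter_iff, Set.mem_union]; tauto

lemma abs_real_inter_sub_le {X : Type*} [MeasurableSpace X] {μ : Measure X} [IsFiniteMeasure μ]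
    (A B A' B' : Set X) : |μ.real (A ∩ B) - μ.real (A' ∩ B')| ≤
      μ.real (symmDiff A A') + μ.real (symmDiff B B') :=
  (abs_real_sub_le _ _).trans ((measureReal_mono (symmDiff_inter_sub _ _ _ _)).trans
    (measureReal_union_le _ _))

variable {lam : Measure (ℕ → Bool)} [IsProbabilityMeasure lam]

lemma sum_cells_s2 (N : ℕ) (D : Set (ℕ → Bool)) :
    ∑ v, lam.real (D ∩ prr N ⁻¹' {v}) = lam.real D := by
  have h := sum_measureReal_preimage_singleton (μ := lam.restrict D) (f := prr N) Finset.univ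
    (fun y _ => measurable_prr N (measurableSet_singleton y))
  simp only [Finset.coe_univ, Set.preimage_univ] at h
  rw [measureReal_restrict_apply_univ] at h
  rw [← h]
  refine Finset.sum_congr rfl fun v _ => ?_
  rw [measureReal_restrict_apply (measurable_prr N (measurableSet_singleton v)), Set.inter_comm]

lemma sum_min_le (N : ℕ) (C K : Set (ℕ → Bool)) :
    ∑ v, min (lam.real (C ∩ prr N ⁻¹' {v})) (lam.real (prr N ⁻¹' {v} \ C)) ≤
    ∑ v, min (lam.real (K ∩ prr N ⁻¹' {v})) (lam.real (prr N ⁻¹' {v} \ K)) +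
      lam.real (symmDiff K C) := by
  rw [← sum_cells_s2 N (symmDiff K C), ← Finset.sum_add_distrib]
  refine Finset.sum_le_sum fun v _ => ?_
  rw [← min_add_add_right]
  refine min_le_min ?_ ?_
  · refine (measureReal_mono ?_).trans (measureReal_union_le _ _)
    intro x; simp only [Set.mem_symmDiff, Set.mem_inter_iff, Set.mem_union]; tauto
  · refine (measureReal_mono ?_).trans (measureReal_union_le _ _)
    intro x; simp only [Set.mem_symmDiff, Set.mem_inter_iff, Set.mem_union, Set.mem_sdiff]; tauto

/-- restriction of words -/
def rst {N M : ℕ} (h : N ≤ M) (u : Fin M → Bool) : Fin N → Bool := fun i => u (Fin.castLE h i)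

lemma rst_prr {N M : ℕ} (h : N ≤ M) (x : ℕ → Bool) : rst h (prr M x) = prr N x := rfl

lemma meas_cell (hl : ∀ N w, lam.real (prr N ⁻¹' {w}) = (2 ^ N : ℝ)⁻¹) {N M : ℕ} (h : N ≤ M)
    (K : Finset (Fin M → Bool)) (v : Fin N → Bool) :
    lam.real (prr M ⁻¹' K ∩ prr N ⁻¹' {v}) =
      ((K.filter fun x => rst h x = v).card : ℝ) * (2 ^ M : ℝ)⁻¹ := by
  rw [← meas_cyl hl]
  congr 1
  ext x
  simp [← rst_prr h]

lemma base_step (hl : ∀ N w, lam.real (prr N ⁻¹' {w}) = (2 ^ N : ℝ)⁻¹)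
    {T : (ℕ → Bool) → (ℕ → Bool)} (hT : Ergodic T lam)
    {𝒞 : Set (Set (ℕ → Bool))} (h𝒞 : ∀ C ∈ 𝒞, MeasurableSet C) {ε : ℝ} (hε : 0 < ε)
    (hC : ∀ N, ∃ C ∈ 𝒞, ε ≤ ∑ v, min (lam.real (C ∩ prr N ⁻¹' {v}))
      (lam.real (prr N ⁻¹' {v} \ C))) (N k : ℕ) :
    ∃ N', N < N' ∧ ∃ π : (ℕ → Bool) ≃ᵐ (ℕ → Bool), Compat π N' ∧
      (∀ x, prr N (π x) = prr N x) ∧ ∃ n, k ≤ n ∧ ∃ C ∈ 𝒞, ∀ ρ : (ℕ → Bool) ≃ᵐ (ℕ → Bool),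
        MeasurePreserving ρ lam lam → (∀ x, prr N' (ρ x) = prr N' (π x)) →
        ε / 16 ≤ birkDev lam (fun x => ρ.symm (T (ρ x))) C n := by
  obtain ⟨C, hCC, hCε⟩ := hC N
  have hCm := h𝒞 C hCC
  have hp : (0 : ℝ) < (2 ^ N : ℝ)⁻¹ := by positivity
  have hn : (0 : ℝ) < ((k + 1 : ℕ) : ℝ) := by positivity
  obtain ⟨E, hE, hEd, hEi⟩ := exists_almost_inv_indep (μ := lam) hT
    (by
      intro δ hδ
      obtain ⟨m, hm⟩ := exists_pow_lt_of_lt_one hδ (by norm_num : (1 / 2 : ℝ) < 1)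
      refine ⟨prr m ⁻¹' {fun _ => false}, measurable_prr m (measurableSet_singleton _), ?_, ?_⟩
      · rw [hl]; positivity
      · rw [hl, ← inv_pow]; simpa using hm.le)
    (fun v : Fin N → Bool => prr N ⁻¹' {v})
    (fun v => measurable_prr N (measurableSet_singleton _))
    (η := (2 ^ N : ℝ)⁻¹ / 16) (δ := ε / 32 / (k + 1 : ℕ)) (by positivity) (by positivity)
  obtain ⟨N₁, h1⟩ := cyls_approx (lam := lam) hCm (e := ε / 128) (by positivity)
  obtain ⟨N₂, h2⟩ := cyls_approx (lam := lam) hE (e := min (ε / 128) ((2 ^ N : ℝ)⁻¹ / 16))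
    (by positivity)
  set M := max (N + 1) (max N₁ N₂) with hM
  have hNM : N < M := lt_of_lt_of_le (Nat.lt_succ_self N) (le_max_left _ _)
  obtain ⟨K, hK⟩ := h1 M ((le_max_left _ _).trans (le_max_right _ _))
  obtain ⟨F, hF⟩ := h2 M ((le_max_right _ _).trans (le_max_right _ _))
  have hF1 := hF.trans_le (min_le_left _ _)
  have hF2 := hF.trans_le (min_le_right _ _)
  have hq : (0 : ℝ) < (2 ^ M : ℝ)⁻¹ := by positivity
  have hcellF := fun v => meas_cell hl hNM.le F v
  have hcellK := fun v => meas_cell hl hNM.le K v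
  have hcellU : ∀ v : Fin N → Bool, (2 ^ N : ℝ)⁻¹ =
      ((Finset.univ.filter fun x => rst hNM.le x = v).card : ℝ) * (2 ^ M : ℝ)⁻¹ := by
    intro v
    rw [← meas_cell hl hNM.le, ← hl N v]; simp
  obtain ⟨σ, hσ, hfar⟩ := exists_perm_far_dec (rst hNM.le) K F (by
    intro v
    have a1 := abs_le.1 (hEi v)
    have a2 := abs_le.1 ((abs_real_inter_sub_le (μ := lam) (prr M ⁻¹' F) (prr N ⁻¹' {v}) E
      (prr N ⁻¹' {v})))
    simp only [symmDiff_self, Set.bot_eq_empty, measureReal_empty, add_zero] at a2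
    rw [hcellF v] at a2
    rw [hl] at a1
    rw [hcellU v] at a1 hF2
    constructor <;> refine le_of_mul_le_mul_right ?_ hq <;> linarith [a1.1, a1.2, a2.1, a2.2])
    (lam.real (prr M ⁻¹' F) * lam.real (prr M ⁻¹' K) * 2 ^ M)
  refine ⟨M, hNM, dy σ, dy_compat σ, ?_, k + 1, Nat.le_succ k, C, hCC, ?_⟩
  · intro x
    rw [← rst_prr hNM.le, ← rst_prr hNM.le, show prr M (dy σ x) = σ (prr M x) from prr_dyf σ x,
      hσ]
  intro ρ hρ hρM
  have hS : MeasurePreserving (fun x => ρ.symm (T (ρ x))) lam lam :=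
    (hρ.symm.comp hT.toMeasurePreserving).comp hρ
  have hE' : MeasurableSet (ρ ⁻¹' E) := ρ.measurable hE
  have hEd' : lam.real (symmDiff ((fun x => ρ.symm (T (ρ x))) ⁻¹' (ρ ⁻¹' E)) (ρ ⁻¹' E)) ≤
      ε / 32 / (k + 1 : ℕ) := by
    have : symmDiff ((fun x => ρ.symm (T (ρ x))) ⁻¹' (ρ ⁻¹' E)) (ρ ⁻¹' E) =
        ρ ⁻¹' (symmDiff (T ⁻¹' E) E) := by
      ext x; simp [Set.mem_symmDiff]
    rw [this, hρ.measureReal_preimage]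
    · exact hEd
    · exact ((hT.measurable hE).symmDiff hE).nullMeasurableSet
  have hfin := birkDev_ge hS hE' hCm hEd' (Nat.succ_pos k)
  have hnd : ((k + 1 : ℕ) : ℝ) * (ε / 32 / (k + 1 : ℕ)) = ε / 32 := by field_simp
  have b1 : lam.real (ρ ⁻¹' E) = lam.real E := hρ.measureReal_preimage hE.nullMeasurableSet
  have b2 : ρ ⁻¹' (prr M ⁻¹' F) ∩ prr M ⁻¹' K = prr M ⁻¹' (K.filter fun x => σ x ∈ F) := by
    ext x
    simp only [Set.mem_inter_iff, Set.mem_preimage, hρM, Finset.coe_filter, Set.mem_ofPred_eq,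
      show prr M (dy σ x) = σ (prr M x) from prr_dyf σ x, Finset.mem_coe]
    tauto
  have b3 : lam.real (symmDiff (ρ ⁻¹' (prr M ⁻¹' F)) (ρ ⁻¹' E)) =
      lam.real (symmDiff (prr M ⁻¹' F) E) := by
    rw [← Set.preimage_symmDiff, hρ.measureReal_preimage]
    exact ((measurable_prr M F.measurableSet).symmDiff hE).nullMeasurableSet
  have b4 := abs_le.1 (abs_real_inter_sub_le (μ := lam) (ρ ⁻¹' (prr M ⁻¹' F)) (prr M ⁻¹' K)
    (ρ ⁻¹' E) C)
  rw [b3, b2, meas_cyl hl] at b4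
  have b5 := sum_min_le (lam := lam) N C (prr M ⁻¹' K)
  have b6 : ∑ v, min (lam.real (prr M ⁻¹' K ∩ prr N ⁻¹' {v}))
      (lam.real (prr N ⁻¹' {v} \ prr M ⁻¹' K)) =
      (∑ v, min ((K.filter fun x => rst hNM.le x = v).card : ℝ)
        (((Finset.univ.filter fun x => rst hNM.le x = v).card : ℝ) -
          (K.filter fun x => rst hNM.le x = v).card)) * (2 ^ M : ℝ)⁻¹ := by
    rw [Finset.sum_mul]
    refine Finset.sum_congr rfl fun v _ => ?_
    rw [min_mul_of_nonneg _ _ hq.le, sub_mul, ← hcellK v, ← hcellU v, ← hl N v]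
    congr 1
    have := measureReal_inter_add_sdiff (μ := lam) (s := prr N ⁻¹' {v})
      (measurable_prr M K.measurableSet)
    rw [Set.inter_comm] at this
    linarith
  have hfar' : 1 / 4 * (ε - ε / 128) ≤ |((K.filter fun x => σ x ∈ F).card : ℝ) * (2 ^ M : ℝ)⁻¹ -
      lam.real (prr M ⁻¹' F) * lam.real (prr M ⁻¹' K)| := by
    have c1 := mul_le_mul_of_nonneg_right hfar hq.le
    rw [← abs_of_pos hq, ← abs_mul, abs_of_pos hq, sub_mul, mul_assoc, ← b6,
      mul_assoc _ (2 ^ M : ℝ) (2 ^ M : ℝ)⁻¹, mul_inv_cancel₀ (by positivity), mul_one] at c1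
    linarith
  have d1 : |lam.real (prr M ⁻¹' F) * lam.real (prr M ⁻¹' K) - lam.real E * lam.real C| ≤
      ε / 64 := by
    have e1 := abs_real_sub_le (μ := lam) (prr M ⁻¹' F) E
    have e2 := abs_real_sub_le (μ := lam) (prr M ⁻¹' K) C
    have : lam.real (prr M ⁻¹' F) * lam.real (prr M ⁻¹' K) - lam.real E * lam.real C =
      (lam.real (prr M ⁻¹' F) - lam.real E) * lam.real (prr M ⁻¹' K) +
      lam.real E * (lam.real (prr M ⁻¹' K) - lam.real C) := by ring
    rw [this]
    refine (abs_add_le _ _).trans ?_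
    rw [abs_mul, abs_mul, abs_of_nonneg (measureReal_nonneg (μ := lam) (s := E)),
      abs_of_nonneg (measureReal_nonneg (μ := lam) (s := prr M ⁻¹' K))]
    have e3 := mul_le_of_le_one_right (abs_nonneg (lam.real (prr M ⁻¹' F) - lam.real E))
      (measureReal_le_one (μ := lam) (s := prr M ⁻¹' K))
    have e4 := mul_le_of_le_one_left (abs_nonneg (lam.real (prr M ⁻¹' K) - lam.real C))
      (measureReal_le_one (μ := lam) (s := E))
    linarith
  rw [hnd, b1] at hfin
  refine le_trans ?_ hfin
  have d1' := abs_le.1 d1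
  rcases le_abs.1 hfar' with h | h
  · have := le_abs_self (lam.real (ρ ⁻¹' E ∩ C) - lam.real E * lam.real C)
    linarith [b4.1, b4.2, d1'.1, d1'.2]
  · have := neg_abs_le (lam.real (ρ ⁻¹' E ∩ C) - lam.real E * lam.real C)
    linarith [b4.1, b4.2, d1'.1, d1'.2]
end BasePart2


section LimPart

lemma lim_equiv (θ : ℕ → (ℕ → Bool) ≃ᵐ (ℕ → Bool)) (N : ℕ → ℕ) (hN : StrictMono N)
    (hc : ∀ k, Compat (θ k) (N k))
    (hs : ∀ k x, prr (N k) (θ (k + 1) x) = prr (N k) (θ k x)) :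
    ∃ Θ : (ℕ → Bool) ≃ᵐ (ℕ → Bool), ∀ k x, prr (N k) (Θ x) = prr (N k) (θ k x) := by
  have h1 : ∀ k j, k ≤ j → ∀ x, prr (N k) (θ j x) = prr (N k) (θ k x) := by
    intro k j hkj x
    induction j, hkj using Nat.le_induction with
    | base => rfl
    | succ j hj ih => rw [← ih]; exact prr_mono (hN.monotone hj) (hs j x)
  have h2 : ∀ k j, k ≤ j → ∀ y, prr (N k) ((θ j).symm y) = prr (N k) ((θ k).symm y) := by
    intro k j hkj y
    rw [hc k (N k) le_rfl, ← h1 k j hkj]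
    simp
  have key : ∀ g : ℕ → (ℕ → Bool) → (ℕ → Bool),
      (∀ k j, k ≤ j → ∀ x, prr (N k) (g j x) = prr (N k) (g k x)) →
      ∀ k x, prr (N k) (fun i => g (i + 1) x i) = prr (N k) (g k x) := by
    intro g hg k x
    rw [prr_eq_iff]
    intro i hi
    have a1 := prr_eq_iff.1 (hg k (max k (i + 1)) (le_max_left _ _) x) i hi
    have a2 := prr_eq_iff.1 (hg (i + 1) (max k (i + 1)) (le_max_right _ _) x) i
      (lt_of_lt_of_le (Nat.lt_succ_self i) (hN.id_le _))
    rw [← a1, ← a2]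
  have ext' : ∀ x y, (∀ k, prr (N k) x = prr (N k) y) → x = y := by
    intro x y h
    funext i
    exact prr_eq_iff.1 (h (i + 1)) i (lt_of_lt_of_le (Nat.lt_succ_self i) (hN.id_le _))
  have k1 := key (fun k => θ k) h1
  have k2 := key (fun k => (θ k).symm) h2
  have hm : ∀ g : ℕ → (ℕ → Bool) ≃ᵐ (ℕ → Bool), Measurable fun x => (fun i => g (i + 1) x i) :=
    fun g => measurable_pi_lambda _ fun i => (measurable_pi_apply i).comp (g (i + 1)).measurable
  refine ⟨⟨⟨fun x i => θ (i + 1) x i, fun x i => (θ (i + 1)).symm x i, ?_, ?_⟩, hm θ,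
    hm fun k => (θ k).symm⟩, k1⟩
  · intro x
    refine ext' _ _ fun k => ?_
    rw [k2, hc k (N k) le_rfl]
    simpa using k1 k x
  · intro x
    refine ext' _ _ fun k => ?_
    rw [k1, (hc k (N k) le_rfl _ _).1 (k2 k x)]
    simp

variable {lam : Measure (ℕ → Bool)} [IsProbabilityMeasure lam]

lemma ergodic_conj {X Y : Type*} [MeasurableSpace X] [MeasurableSpace Y] {μ : Measure X}
    {ν : Measure Y} {T : X → X} (hT : Ergodic T μ) (e : Y ≃ᵐ X) (he : MeasurePreserving e ν μ) :
    Ergodic (fun y => e.symm (T (e y))) ν := by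
  have := (MeasurePreserving.ergodic_conjugate_iff (f := T) (he.symm)).2 hT
  exact this

lemma exists_theta (hl : ∀ N w, lam.real (prr N ⁻¹' {w}) = (2 ^ N : ℝ)⁻¹)
    {T : (ℕ → Bool) → (ℕ → Bool)} (hT : Ergodic T lam)
    {𝒞 : Set (Set (ℕ → Bool))} (h𝒞 : ∀ C ∈ 𝒞, MeasurableSet C) {ε : ℝ} (hε : 0 < ε)
    (hC : ∀ N, ∃ C ∈ 𝒞, ε ≤ ∑ v, min (lam.real (C ∩ prr N ⁻¹' {v}))
      (lam.real (prr N ⁻¹' {v} \ C))) (N₀ : ℕ) :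
    ∃ θ : (ℕ → Bool) ≃ᵐ (ℕ → Bool), MeasurePreserving θ lam lam ∧
      (∀ x, prr N₀ (θ x) = prr N₀ x) ∧
      ∀ k, ∃ n, k ≤ n ∧ ∃ C ∈ 𝒞, ε / 16 ≤ birkDev lam (fun x => θ.symm (T (θ x))) C n := by
  have step : ∀ (s : {p : ((ℕ → Bool) ≃ᵐ (ℕ → Bool)) × ℕ // Compat p.1 p.2}) (k : ℕ),
      ∃ s' : {p : ((ℕ → Bool) ≃ᵐ (ℕ → Bool)) × ℕ // Compat p.1 p.2}, s.1.2 < s'.1.2 ∧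
        (∀ x, prr s.1.2 (s'.1.1 x) = prr s.1.2 (s.1.1 x)) ∧
        ∃ n, k ≤ n ∧ ∃ C ∈ 𝒞, ∀ θ : (ℕ → Bool) ≃ᵐ (ℕ → Bool), MeasurePreserving θ lam lam →
          (∀ x, prr s'.1.2 (θ x) = prr s'.1.2 (s'.1.1 x)) →
          ε / 16 ≤ birkDev lam (fun x => θ.symm (T (θ x))) C n := by
    rintro ⟨⟨θ₁, N⟩, hc⟩ k
    have hmp : MeasurePreserving θ₁ lam lam :=
      mp_of_compat hl θ₁ fun m => ⟨max m N, le_max_left _ _, hc _ (le_max_right _ _)⟩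
    obtain ⟨N', hN', π, hπ, hπN, n, hn, C, hCC, hfin⟩ :=
      base_step hl (ergodic_conj hT θ₁ hmp) h𝒞 hε hC N k
    refine ⟨⟨⟨π.trans θ₁, N'⟩, ?_⟩, hN', ?_, n, hn, C, hCC, ?_⟩
    · intro M hM x y
      rw [hπ M hM, hc M (hN'.le.trans hM)]
      rfl
    · intro x
      exact (hc N le_rfl _ _).1 (hπN x)
    · intro θ hθ hx
      have := hfin (θ.trans θ₁.symm) (hmp.symm.comp hθ) (by
        intro x
        rw [hc N' hN'.le]
        have := hx x
        simpa using this)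
      simpa using this
  choose f hf1 hf2 hf3 using step
  let s : ℕ → {p : ((ℕ → Bool) ≃ᵐ (ℕ → Bool)) × ℕ // Compat p.1 p.2} := fun k =>
    Nat.rec ⟨⟨MeasurableEquiv.refl _, N₀⟩, fun _ _ _ _ => Iff.rfl⟩ (fun k s => f s k) k
  have hs : ∀ k, s (k + 1) = f (s k) k := fun k => rfl
  obtain ⟨Θ, hΘ⟩ := lim_equiv (fun k => (s k).1.1) (fun k => (s k).1.2)
    (strictMono_nat_of_lt_succ fun k => by rw [hs]; exact hf1 _ _) (fun k => (s k).2)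
    (fun k x => by rw [hs]; exact hf2 _ _ x)
  have hmono : StrictMono (fun k => (s k).1.2) :=
    strictMono_nat_of_lt_succ fun k => by rw [hs]; exact hf1 _ _
  have hmp : MeasurePreserving Θ lam lam := by
    refine mp_of_compat hl Θ fun m => ⟨_, hmono.id_le m, fun x y => ?_⟩
    rw [hΘ, hΘ]
    exact (s m).2 _ le_rfl x y
  refine ⟨Θ, hmp, fun x => hΘ 0 x, fun k => ?_⟩
  obtain ⟨n, hn, C, hCC, h⟩ := hf3 (s k) k
  exact ⟨n, hn, C, hCC, h Θ hmp fun x => hΘ (k + 1) x⟩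
end LimPart


section IsoPart

lemma coin_exists : ∃ lam : Measure (ℕ → Bool), IsProbabilityMeasure lam ∧
    ∀ N w, lam.real (prr N ⁻¹' {w}) = (2 ^ N : ℝ)⁻¹ := by
  let b : Measure Bool := (PMF.uniformOfFintype Bool).toMeasure
  refine ⟨Measure.infinitePi (fun _ : ℕ => b), inferInstance, fun N w => ?_⟩
  have h1 : prr N ⁻¹' {w} = Set.pi (Finset.range N)
      (fun i => if h : i < N then {w ⟨i, h⟩} else Set.univ) := by
    ext x
    simp only [Set.mem_preimage, Set.mem_singleton_iff, Set.mem_pi, Finset.coe_range, Set.mem_Iio]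
    constructor
    · rintro rfl i hi
      simp [hi, prr]
    · intro h
      funext i
      simpa [prr] using h i i.2
  rw [h1, measureReal_def, Measure.infinitePi_pi]
  · have h2 : ∀ i ∈ Finset.range N, b (if h : i < N then {w ⟨i, h⟩} else Set.univ) = 2⁻¹ := by
      intro i hi
      rw [dif_pos (Finset.mem_range.1 hi), PMF.toMeasure_apply_singleton _ _ (by simp)]
      simp
    rw [Finset.prod_congr rfl h2]
    simp
  · intro i _
    exact (Set.toFinite _).measurableSet

lemma uncountable_of_atomless {X : Type*} [MeasurableSpace X] {μ : Measure X}
    [IsProbabilityMeasure μ] (h : ∀ x, μ {x} = 0) : ¬ Countable X := by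
  intro hc
  have h1 : μ (⋃ x : X, {x}) = 0 := measure_iUnion_null h
  rw [Set.iUnion_of_singleton, measure_univ] at h1
  exact one_ne_zero h1

lemma exists_null_uncountable {X : Type*} [MeasurableSpace X] [StandardBorelSpace X]
    {μ : Measure X} [IsProbabilityMeasure μ] (h : ∀ x, μ {x} = 0) :
    ∃ S : Set X, MeasurableSet S ∧ μ S = 0 ∧ ¬ S.Countable := by
  have hX := uncountable_of_atomless h
  have hR : ¬ Countable ℝ := by simp
  have hRR : ¬ Countable (ℝ × ℝ) := fun hc =>
    hR (Function.Injective.countable (f := fun x : ℝ => (x, x)) fun a b hab => by simpa using hab)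
  let e : X ≃ᵐ ℝ × ℝ := PolishSpace.measurableEquivOfNotCountable hX hRR
  let S : ℝ → Set X := fun t => e ⁻¹' (Prod.fst ⁻¹' {t})
  have hS : ∀ t, MeasurableSet (S t) := fun t =>
    e.measurable (measurable_fst (measurableSet_singleton t))
  have hcount : {t | 0 < μ (S t)}.Countable := by
    refine Measure.countable_meas_pos_of_disjoint_iUnion hS ?_
    intro a b hab
    refine Set.disjoint_left.2 fun x hx hx' => hab ?_
    exact (hx : (e x).1 = a).symm.trans hx'
  have : ∃ t, μ (S t) = 0 := by
    by_contra hcon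
    push Not at hcon
    refine hR (Set.countable_univ_iff.1 (hcount.mono fun t _ => ?_))
    exact pos_iff_ne_zero.2 (hcon t)
  obtain ⟨t, ht⟩ := this
  refine ⟨S t, hS t, ht, fun hc => hR ?_⟩
  have hinj : Function.Injective (fun y : ℝ => (⟨e.symm (t, y), by simp [S]⟩ : S t)) := by
    intro a b hab
    have := congrArg (fun z : S t => (e z.1).2) hab
    simpa using this
  have : Countable (S t) := hc.to_subtype
  exact hinj.countable

open Classical in
lemma iso_upgrade {X Y : Type*} [MeasurableSpace X] [StandardBorelSpace X]
    [MeasurableSpace Y] [StandardBorelSpace Y] {μ : Measure X} {ν : Measure Y}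
    [IsProbabilityMeasure ν] (hν : ∀ y, ν {y} = 0) {g : Y → X} (hg : MeasurePreserving g ν μ)
    (hi : Function.Injective g) : ∃ e : Y ≃ᵐ X, MeasurePreserving e ν μ := by
  obtain ⟨S, hS, hS0, hSc⟩ := exists_null_uncountable hν
  have hemb : MeasurableEmbedding g := hg.measurable.measurableEmbedding hi
  have hA : MeasurableSet (g '' Sᶜ) := hemb.measurableSet_image.2 hS.compl
  have hB : ¬ (g '' Sᶜ)ᶜ.Countable := by
    intro hc
    apply hSc
    have : g '' S ⊆ (g '' Sᶜ)ᶜ := by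
      rintro _ ⟨x, hx, rfl⟩ ⟨y, hy, hxy⟩
      exact hy (hi hxy ▸ hx)
    exact Set.countable_of_injective_of_countable_image hi.injOn (hc.mono this)
  have i1 : StandardBorelSpace (Sᶜᶜ : Set Y) := hS.compl.compl.standardBorel
  have i2 : StandardBorelSpace ((g '' Sᶜ)ᶜ : Set X) := hA.compl.standardBorel
  have hSc' : ¬ Countable (Sᶜᶜ : Set Y) := fun h =>
    hSc (by simpa using Set.countable_coe_iff.1 h)
  have hB' : ¬ Countable ((g '' Sᶜ)ᶜ : Set X) := fun h => hB (Set.countable_coe_iff.1 h)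
  let e1 : (Sᶜᶜ : Set Y) ≃ᵐ ((g '' Sᶜ)ᶜ : Set X) := PolishSpace.measurableEquivOfNotCountable hSc' hB'
  let e2 : (Sᶜ : Set Y) ≃ᵐ (g '' Sᶜ : Set X) := hemb.equivImage _
  let e : Y ≃ᵐ X := (MeasurableEquiv.sumCompl hS.compl).symm.trans
    ((MeasurableEquiv.sumCongr e2 e1).trans (MeasurableEquiv.sumCompl hA))
  have he : ∀ y ∉ S, e y = g y := by
    intro y hy
    have : (MeasurableEquiv.sumCompl hS.compl).symm y = Sum.inl ⟨y, hy⟩ := by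
      rw [MeasurableEquiv.symm_apply_eq]; rfl
    simp only [e, MeasurableEquiv.trans_apply, this]
    rfl
  refine ⟨e, e.measurable, ?_⟩
  rw [← hg.map_eq]
  refine Measure.map_congr ?_
  have : Sᶜ ∈ ae ν := by rw [mem_ae_iff, compl_compl]; exact hS0
  filter_upwards [this] with y hy
  exact he y hy

lemma iso_real {μ : Measure ℝ} [IsProbabilityMeasure μ] (h : ∀ x, μ {x} = 0) :
    ∃ e : Set.Ioo (0 : ℝ) 1 ≃ᵐ ℝ,
      MeasurePreserving e (Measure.comap Subtype.val (volume : Measure ℝ)) μ := by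
  set F := ProbabilityTheory.cdf μ with hF
  have hmono : Monotone F := ProbabilityTheory.monotone_cdf μ
  have hcont : Continuous F := by
    rw [continuous_iff_continuousAt]
    intro x
    rw [hmono.continuousAt_iff_leftLim_eq_rightLim, F.rightLim_eq]
    have h1 := F.measure_singleton x
    rw [hF, ProbabilityTheory.measure_cdf, h x] at h1
    have h2 := ENNReal.ofReal_eq_zero.1 h1.symm
    have h3 := hmono.leftLim_le (le_refl x)
    exact le_antisymm h3 (by linarith)
  have hsurj : ∀ u : Set.Ioo (0 : ℝ) 1, ∃ x, F x = u := by
    intro u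
    have h1 := (ProbabilityTheory.tendsto_cdf_atBot μ).eventually (gt_mem_nhds u.2.1)
    have h2 := (ProbabilityTheory.tendsto_cdf_atTop μ).eventually (lt_mem_nhds u.2.2)
    obtain ⟨a, ha⟩ := h1.exists
    obtain ⟨b, hb⟩ := h2.exists
    exact mem_range_of_exists_le_of_exists_ge hcont ⟨a, ha.le⟩ ⟨b, hb.le⟩
  choose g hg using hsurj
  have hgm : StrictMono g := by
    intro u v huv
    by_contra hcon
    have := hmono (not_lt.1 hcon)
    rw [hg, hg] at this
    exact absurd huv (not_lt.2 this)
  have hme : MeasurableEmbedding (Subtype.val : Set.Ioo (0 : ℝ) 1 → ℝ) :=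
    MeasurableEmbedding.subtype_coe measurableSet_Ioo
  set ν : Measure (Set.Ioo (0 : ℝ) 1) := Measure.comap Subtype.val volume with hν
  have hνa : ∀ s, ν s = volume (Subtype.val '' s) := fun s => hme.comap_apply _ _
  have hp : IsProbabilityMeasure ν := ⟨by rw [hνa, Set.image_univ, Subtype.range_coe]; simp⟩
  have hn : ∀ y, ν {y} = 0 := by intro y; rw [hνa]; simp
  have hgmeas : Measurable g := hgm.monotone.measurable
  have : StandardBorelSpace (Set.Ioo (0 : ℝ) 1) := measurableSet_Ioo.standardBorel
  refine iso_upgrade hn (g := g) ⟨hgmeas, ?_⟩ hgm.injective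
  have : IsProbabilityMeasure (ν.map g) := Measure.isProbabilityMeasure_map hgmeas.aemeasurable
  refine Measure.ext_of_Iic _ _ fun x => ?_
  rw [Measure.map_apply hgmeas measurableSet_Iic, ← ProbabilityTheory.ofReal_cdf, hνa]
  have hx0 : 0 ≤ F x := ProbabilityTheory.cdf_nonneg μ x
  have hx1 : F x ≤ 1 := ProbabilityTheory.cdf_le_one μ x
  refine le_antisymm ?_ ?_
  · refine (measure_mono (t := Set.Ioc 0 (F x)) ?_).trans (by simp [hF])
    rintro _ ⟨u, hu, rfl⟩
    refine ⟨u.2.1, ?_⟩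
    rw [← hg u]
    exact hmono hu
  · refine le_trans (by simp [hF]) (measure_mono (s := Set.Ioo 0 (F x)) ?_)
    rintro u ⟨hu0, hu1⟩
    refine ⟨⟨u, hu0, hu1.trans_le hx1⟩, ?_, rfl⟩
    by_contra hcon
    have h1 := hmono (le_of_lt (not_le.1 hcon))
    rw [hg] at h1
    exact absurd hu1 (not_lt.2 h1)

lemma iso_any {X : Type*} [MeasurableSpace X] [StandardBorelSpace X]
    {μ : Measure X} [IsProbabilityMeasure μ] (h : ∀ x, μ {x} = 0) :
    ∃ e : Set.Ioo (0 : ℝ) 1 ≃ᵐ X,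
      MeasurePreserving e (Measure.comap Subtype.val (volume : Measure ℝ)) μ := by
  have hR : ¬ Countable ℝ := by simp
  let e : X ≃ᵐ ℝ := PolishSpace.measurableEquivOfNotCountable (uncountable_of_atomless h) hR
  have he : MeasurePreserving e μ (μ.map e) := ⟨e.measurable, rfl⟩
  have : IsProbabilityMeasure (μ.map e) :=
    Measure.isProbabilityMeasure_map e.measurable.aemeasurable
  obtain ⟨f, hf⟩ := iso_real (μ := μ.map e) (by
    intro x
    rw [Measure.map_apply e.measurable (measurableSet_singleton x)]
    have : e ⁻¹' {x} = {e.symm x} := by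
      ext y; simp [MeasurableEquiv.eq_symm_apply]
    rw [this, h])
  exact ⟨f.trans e.symm, he.symm.comp hf⟩

lemma iso_two {X Y : Type*} [MeasurableSpace X] [StandardBorelSpace X]
    [MeasurableSpace Y] [StandardBorelSpace Y]
    {μ : Measure X} [IsProbabilityMeasure μ] {ν : Measure Y} [IsProbabilityMeasure ν]
    (h : ∀ x, μ {x} = 0) (h' : ∀ y, ν {y} = 0) :
    ∃ e : X ≃ᵐ Y, MeasurePreserving e μ ν := by
  obtain ⟨e, he⟩ := iso_any h
  obtain ⟨f, hf⟩ := iso_any h'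
  exact ⟨e.symm.trans f, hf.comp he.symm⟩
end IsoPart


section RedPart

open Classical in
lemma no_atoms {X : Type*} [MeasurableSpace X] [MeasurableSingletonClass X]
    (μ : Measure X) [IsProbabilityMeasure μ] (T : X ≃ᵐ X) (hT : Ergodic (⇑T) μ)
    (𝒞 : Set (Set X)) (h𝒞 : ∀ C ∈ 𝒞, MeasurableSet C) (hent : 0 < famEntropy μ 𝒞) (x₀ : X) :
    μ {x₀} = 0 := by
  by_contra hx
  refine absurd hent (not_lt.2 (famEntropy_nonpos μ 𝒞 h𝒞 fun ε hε => ?_))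
  let O : Set X := Set.range fun i : ℕ => T^[i] x₀
  have hOm : MeasurableSet O := (Set.countable_range _).measurableSet
  have hO : μ Oᶜ = 0 := by
    have h1 : O ⊆ T ⁻¹' O := by
      rintro _ ⟨i, rfl⟩
      exact ⟨i + 1, Function.iterate_succ_apply' _ _ _⟩
    rcases hT.ae_empty_or_univ_of_ae_le_preimage hOm.nullMeasurableSet
      (LE.le.eventuallyLE h1) with h | h
    · exfalso
      have h2 : μ O = 0 := by rw [measure_congr h]; simp
      exact hx (measure_mono_null (Set.singleton_subset_iff.2 (⟨0, rfl⟩ : x₀ ∈ O)) h2)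
    · rw [ae_eq_univ] at h; exact h
  let A : ℕ → Set X := fun m => {x | ∀ i < m, x ≠ T^[i] x₀}
  have hAm : ∀ m, MeasurableSet (A m) := by
    intro m
    have : A m = (((fun i => T^[i] x₀) '' (Finset.range m : Set ℕ)))ᶜ := by
      ext x
      simp only [A, Set.mem_ofPred_eq, Set.mem_compl_iff, Set.mem_image, Finset.coe_range,
        Set.mem_Iio, not_exists, not_and]
      exact ⟨fun h i hi he => h i hi he.symm, fun h i hi he => h i hi he.symm⟩
    rw [this]
    exact ((Finset.finite_toSet _).image _).measurableSet.compl
  have hA : Antitone A := fun m n hmn x hx i hi => hx i (hi.trans_le hmn)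
  have hlim := tendsto_measure_iInter_atTop (μ := μ) (fun m => (hAm m).nullMeasurableSet) hA
    ⟨0, measure_ne_top _ _⟩
  have hAO : ⋂ m, A m = Oᶜ := by
    ext x
    simp only [A, O, Set.mem_iInter, Set.mem_ofPred_eq, Set.mem_compl_iff, Set.mem_range,
      not_exists]
    exact ⟨fun h i he => h (i + 1) i (Nat.lt_succ_self i) he.symm, fun h m i _ he => h i he.symm⟩
  rw [hAO, hO] at hlim
  obtain ⟨m, hm⟩ := (hlim.eventually (gt_mem_nhds (ENNReal.ofReal_pos.2 hε))).exists
  refine ⟨m, fun x i => decide (x = T^[(i : ℕ)] x₀), ?_, ?_⟩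
  · refine measurable_pi_lambda _ fun i => ?_
    refine measurable_to_bool ?_
    have : (fun x => decide (x = T^[(i : ℕ)] x₀)) ⁻¹' {true} = {T^[(i : ℕ)] x₀} := by
      ext x; simp
    rw [this]
    exact measurableSet_singleton _
  · intro C hC
    refine ⟨fun v => decide (∃ i : Fin m, v i = true ∧ T^[(i : ℕ)] x₀ ∈ C), ?_⟩
    refine le_trans (measureReal_mono (s₂ := A m) ?_)
      ((ENNReal.lt_ofReal_iff_toReal_lt (measure_ne_top _ _)).1 hm).le
    intro x hx i hi he
    apply hx
    rw [decide_eq_decide]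
    constructor
    · intro h
      exact ⟨⟨i, hi⟩, by simpa using he, he ▸ h⟩
    · rintro ⟨j, hj, hjC⟩
      have := of_decide_eq_true hj
      rw [this]; exact hjC

open Classical in
lemma exists_eps {X : Type*} [MeasurableSpace X]
    (μ : Measure X) [IsProbabilityMeasure μ] {lam : Measure (ℕ → Bool)} [IsProbabilityMeasure lam]
    (e : X ≃ᵐ (ℕ → Bool)) (he : MeasurePreserving e μ lam)
    (𝒞 : Set (Set X)) (h𝒞 : ∀ C ∈ 𝒞, MeasurableSet C) (hent : 0 < famEntropy μ 𝒞) :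
    ∃ ε : ℝ, 0 < ε ∧ ∀ N, ∃ C' ∈ {C' | ∃ C ∈ 𝒞, C' = e.symm ⁻¹' C},
      ε ≤ ∑ v, min (lam.real (C' ∩ prr N ⁻¹' {v})) (lam.real (prr N ⁻¹' {v} \ C')) := by
  by_contra hcon
  push Not at hcon
  refine absurd hent (not_lt.2 (famEntropy_nonpos μ 𝒞 h𝒞 fun ε hε => ?_))
  obtain ⟨N, hN⟩ := hcon ε hε
  refine ⟨N, fun x => prr N (e x), (measurable_prr N).comp e.measurable, fun C hC => ?_⟩
  have h1 := hN _ ⟨C, hC, rfl⟩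
  have hC' : MeasurableSet (e.symm ⁻¹' C) := e.symm.measurable (h𝒞 C hC)
  set C' := e.symm ⁻¹' C with hC'def
  let d : (Fin N → Bool) → Bool := fun v =>
    decide (lam.real (prr N ⁻¹' {v} \ C') ≤ lam.real (C' ∩ prr N ⁻¹' {v}))
  refine ⟨d, le_trans ?_ h1.le⟩
  let D : Set (ℕ → Bool) := {y | decide (y ∈ C') ≠ d (prr N y)}
  have hDm : MeasurableSet D := by
    have h2 : Measurable fun y => decide (y ∈ C') := by
      refine measurable_to_bool ?_
      convert hC'
      ext y; simp
    exact (measurableSet_eq_fun h2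
      ((measurable_of_countable d).comp (measurable_prr N))).compl
  have e1 : {x | decide (x ∈ C) ≠ d (prr N (e x))} = e ⁻¹' D := by
    ext x
    simp [D, hC'def]
  rw [e1, he.measureReal_preimage hDm.nullMeasurableSet, ← sum_cells_s2 N D]
  refine Finset.sum_le_sum fun v _ => ?_
  by_cases hv : lam.real (prr N ⁻¹' {v} \ C') ≤ lam.real (C' ∩ prr N ⁻¹' {v})
  · rw [min_eq_right hv]
    refine measureReal_mono ?_
    rintro y ⟨hy, hyv⟩
    refine ⟨hyv, fun hyC => hy ?_⟩
    rw [show prr N y = v from hyv]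
    simp only [d, hv, hyC]
  · rw [min_eq_left (not_le.1 hv).le]
    refine measureReal_mono ?_
    rintro y ⟨hy, hyv⟩
    refine ⟨by_contra fun hyC => hy ?_, hyv⟩
    rw [show prr N y = v from hyv]
    simp only [d, hv, hyC]
end RedPart


section FinPart

lemma iterate_conj {X Y : Type*} (e : X ≃ Y) (T : Y → Y) (i : ℕ) (x : X) :
    (fun x => e.symm (T (e x)))^[i] x = e.symm (T^[i] (e x)) := by
  induction i generalizing x with
  | zero => simp
  | succ i ih => rw [Function.iterate_succ_apply, ih]; simp

lemma birkDev_conj {X Y : Type*} [MeasurableSpace X] [MeasurableSpace Y] {μ : Measure X}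
    {ν : Measure Y} (e : X ≃ᵐ Y) (he : MeasurePreserving e μ ν) (T : Y → Y) {C : Set X}
    (hC : MeasurableSet C) (n : ℕ) :
    birkDev μ (fun x => e.symm (T (e x))) C n = birkDev ν T (e.symm ⁻¹' C) n := by
  unfold birkDev
  rw [← he.integral_comp e.measurableEmbedding, he.symm.measure_preimage hC.nullMeasurableSet]
  have := fun i x => iterate_conj e.toEquiv T i x
  simp only [MeasurableEquiv.coe_toEquiv, MeasurableEquiv.coe_toEquiv_symm] at this
  simp only [this]
  rfl

lemma birkDev_le_one {X : Type*} [MeasurableSpace X] {μ : Measure X} [IsProbabilityMeasure μ]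
    (T : X → X) (C : Set X) (n : ℕ) : |birkDev μ T C n| ≤ 1 := by
  unfold birkDev
  have := norm_integral_le_of_norm_le_const (μ := μ) (C := 1) (f := fun x =>
    |(∑ i ∈ Finset.range n, C.indicator (fun _ => (1 : ℝ)) (T^[i] x)) / n - (μ C).toReal|)
    (Eventually.of_forall fun x => by
      rw [Real.norm_eq_abs, abs_abs]
      have h1 : (μ C).toReal ≤ 1 := measureReal_le_one (μ := μ) (s := C)
      have h2 : 0 ≤ (μ C).toReal := ENNReal.toReal_nonneg
      have h3 : 0 ≤ ∑ i ∈ Finset.range n, C.indicator (fun _ => (1 : ℝ)) (T^[i] x) :=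
        Finset.sum_nonneg fun i _ => Set.indicator_nonneg (fun _ _ => zero_le_one) _
      have h4 : ∑ i ∈ Finset.range n, C.indicator (fun _ => (1 : ℝ)) (T^[i] x) ≤ n := by
        refine (Finset.sum_le_sum (g := fun _ => (1 : ℝ)) fun i _ => ?_).trans (by simp)
        exact Set.indicator_le_self' (fun _ _ => zero_le_one) _
      have h5 : (∑ i ∈ Finset.range n, C.indicator (fun _ => (1 : ℝ)) (T^[i] x)) / n ≤ 1 :=
        div_le_one_of_le₀ h4 (Nat.cast_nonneg n)
      have h6 : 0 ≤ (∑ i ∈ Finset.range n, C.indicator (fun _ => (1 : ℝ)) (T^[i] x)) / n := by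
        positivity
      exact abs_le.2 ⟨by linarith, by linarith⟩)
  simpa using this

lemma continuous_birkDev {X : Type*} [MeasurableSpace X] {μ : Measure X} [IsProbabilityMeasure μ]
    (T : X ≃ᵐ X) (hT : MeasurePreserving T μ μ) {C : Set X} (hC : MeasurableSet C) (n : ℕ) :
    Continuous fun φ : MPE μ => birkDev μ (MPE.conj T φ) C n := by
  have h0 : Continuous fun φ : MPE μ =>
      (indicatorConstLp 1 (hC.preimage φ.1.symm.measurable) (measure_ne_top μ _)
        (1 : ℝ) : Lp ℝ 1 μ) := by
    have hι : Continuous (fun φ : MPE μ => fun A : {A : Set X // MeasurableSet A} =>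
      (indicatorConstLp 1 (A.2.preimage φ.1.symm.measurable) (measure_ne_top μ _)
        (1 : ℝ) : Lp ℝ 1 μ)) := continuous_induced_dom
    exact continuous_pi_iff.1 hι ⟨C, hC⟩
  have h1 : ∀ φ : MPE μ, birkDev μ (MPE.conj T φ) C n =
      ‖((n : ℝ)⁻¹ • ∑ i ∈ Finset.range n, Lp.compMeasurePreserving (T^[i]) (hT.iterate i)
        (indicatorConstLp 1 (hC.preimage φ.1.symm.measurable) (measure_ne_top μ _)
        (1 : ℝ) : Lp ℝ 1 μ) -
      indicatorConstLp 1 MeasurableSet.univ (measure_ne_top μ _) (μ C).toReal : Lp ℝ 1 μ)‖ := by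
    intro φ
    have h2 := birkDev_conj φ.1 φ.2 T hC n
    rw [birkDev_eq_norm hT (hC.preimage φ.1.symm.measurable)] at h2
    have h3 : μ (φ.1.symm ⁻¹' C) = μ C :=
      (MeasurePreserving.symm φ.1 φ.2).measure_preimage hC.nullMeasurableSet
    rw [h3] at h2
    exact h2
  simp only [h1]
  have h5 : Continuous fun φ : MPE μ => ∑ i ∈ Finset.range n,
      Lp.compMeasurePreserving (T^[i]) (hT.iterate i)
        (indicatorConstLp 1 (hC.preimage φ.1.symm.measurable) (measure_ne_top μ _)
        (1 : ℝ) : Lp ℝ 1 μ) := by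
    refine continuous_finsetSum _ fun i _ => ?_
    exact (Lp.isometry_compMeasurePreserving (hT.iterate i)).continuous.comp h0
  exact ((continuous_const (y := (n : ℝ)⁻¹)).smul h5).sub continuous_const |>.norm

lemma limsup_pos {X : Type*} [MeasurableSpace X] {μ : Measure X} [IsProbabilityMeasure μ]
    (S : X → X) (𝒞 : Set (Set X)) {ε : ℝ} (hε : 0 < ε)
    (h : ∀ k : ℕ, ∃ n, k ≤ n ∧ ∃ C ∈ 𝒞, ε < birkDev μ S C n) :
    0 < Filter.atTop.limsup (fun n : ℕ => ⨆ C : 𝒞, birkDev μ S C n) := by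
  have hb : ∀ n, BddAbove (Set.range fun C : 𝒞 => birkDev μ S C n) := by
    rintro n
    refine ⟨1, ?_⟩
    rintro _ ⟨C, rfl⟩
    exact (abs_le.1 (birkDev_le_one S C n)).2
  have hne : Nonempty 𝒞 := by
    obtain ⟨n, _, C, hC, _⟩ := h 0
    exact ⟨⟨C, hC⟩⟩
  refine hε.trans_le (le_limsup_of_frequently_le ?_ ?_)
  · rw [frequently_atTop]
    intro k
    obtain ⟨n, hn, C, hC, hlt⟩ := h k
    exact ⟨n, hn, hlt.le.trans (le_ciSup (hb n) ⟨C, hC⟩)⟩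
  · refine ⟨1, ?_⟩
    rw [eventually_map]
    exact Eventually.of_forall fun n => ciSup_le fun C => (abs_le.1 (birkDev_le_one S C n)).2

lemma theta_close {lam : Measure (ℕ → Bool)} [IsProbabilityMeasure lam]
    {θ : (ℕ → Bool) ≃ᵐ (ℕ → Bool)} (hθ : MeasurePreserving θ lam lam) {m : ℕ}
    (hm : ∀ x, prr m (θ x) = prr m x) {B : Set (ℕ → Bool)} (hB : MeasurableSet B)
    (K : Finset (Fin m → Bool)) :
    lam.real (symmDiff (θ.symm ⁻¹' B) B) ≤ 2 * lam.real (symmDiff (prr m ⁻¹' K) B) := by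
  have h1 : θ.symm ⁻¹' (prr m ⁻¹' K) = prr m ⁻¹' K := by
    ext x
    have := hm (θ.symm x)
    rw [θ.apply_symm_apply] at this
    simp [this]
  have h2 : lam.real (symmDiff (prr m ⁻¹' K) (θ.symm ⁻¹' B)) =
      lam.real (symmDiff (prr m ⁻¹' K) B) := by
    conv_lhs => rw [← h1]
    rw [← Set.preimage_symmDiff, hθ.symm.measureReal_preimage]
    exact ((measurable_prr m K.measurableSet).symmDiff hB).nullMeasurableSet
  have h3 : symmDiff (θ.symm ⁻¹' B) B ⊆
      symmDiff (prr m ⁻¹' K) (θ.symm ⁻¹' B) ∪ symmDiff (prr m ⁻¹' K) B := by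
    intro x
    simp only [Set.mem_symmDiff, Set.mem_union]
    tauto
  have h4 := (measureReal_mono (μ := lam) h3).trans (measureReal_union_le _ _)
  linarith

lemma lam_singleton {lam : Measure (ℕ → Bool)} [IsProbabilityMeasure lam]
    (hl : ∀ N w, lam.real (prr N ⁻¹' {w}) = (2 ^ N : ℝ)⁻¹) (y : ℕ → Bool) : lam {y} = 0 := by
  have h1 : ∀ N : ℕ, lam.real {y} ≤ (2 ^ N : ℝ)⁻¹ := fun N => by
    rw [← hl N (prr N y)]
    exact measureReal_mono (by simp)
  have h2 : Tendsto (fun N : ℕ => (2 ^ N : ℝ)⁻¹) atTop (nhds 0) :=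
    tendsto_inv_atTop_zero.comp (tendsto_pow_atTop_atTop_of_one_lt one_lt_two)
  have h3 : lam.real {y} ≤ 0 := ge_of_tendsto' h2 h1
  have h4 := le_antisymm h3 measureReal_nonneg
  simpa [Measure.real, ENNReal.toReal_eq_zero_iff] using h4

lemma tendsto_theta {X : Type*} [MeasurableSpace X] {μ : Measure X} [IsProbabilityMeasure μ]
    {lam : Measure (ℕ → Bool)} [IsProbabilityMeasure lam]
    (e : X ≃ᵐ (ℕ → Bool)) (he : MeasurePreserving e μ lam) (φ₀ : MPE μ)
    (θ : ℕ → ((ℕ → Bool) ≃ᵐ (ℕ → Bool))) (hθ : ∀ m, MeasurePreserving (θ m) lam lam)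
    (hm : ∀ m x, prr m (θ m x) = prr m x) (φ : ℕ → MPE μ)
    (hφ : ∀ m, (φ m).1 = e.trans ((θ m).trans (e.symm.trans φ₀.1))) :
    Tendsto φ atTop (nhds φ₀) := by
  rw [nhds_induced, tendsto_comap_iff, tendsto_pi_nhds]
  rintro ⟨A, hA⟩
  refine tendsto_indicatorConstLp_set (ht := fun m => (φ m).1.symm.measurable hA)
    (hμt := fun _ => measure_ne_top μ _) (by simp) ?_
  have hB : MeasurableSet (e.symm ⁻¹' A) := e.symm.measurable hA
  have hg : MeasurePreserving (fun x => e (φ₀.1.symm x)) μ lam :=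
    he.comp (MeasurePreserving.symm φ₀.1 φ₀.2)
  have h1 : ∀ m, μ (symmDiff ((φ m).1.symm ⁻¹' A) (φ₀.1.symm ⁻¹' A)) =
      ENNReal.ofReal (lam.real (symmDiff ((θ m).symm ⁻¹' (e.symm ⁻¹' A)) (e.symm ⁻¹' A))) := by
    intro m
    rw [ofReal_measureReal, ← hg.measure_preimage]
    · congr 1
      ext x
      simp [hφ, Set.mem_symmDiff]
    · exact (((θ m).symm.measurable hB).symmDiff hB).nullMeasurableSet
  simp only [h1]
  rw [← ENNReal.ofReal_zero]
  refine ENNReal.tendsto_ofReal ?_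
  rw [Metric.tendsto_atTop]
  intro δ hδ
  obtain ⟨N₀, h⟩ := cyls_approx (lam := lam) hB (e := δ / 2) (by positivity)
  refine ⟨N₀, fun m hmN => ?_⟩
  obtain ⟨K, hK⟩ := h m hmN
  have := theta_close (hθ m) (hm m) hB K
  rw [Real.dist_0_eq_abs, abs_of_nonneg measureReal_nonneg]
  linarith

end FinPart

/-- **Strong converse.**  If `T` is an invertible ergodic measure preserving transformation of
a Lebesgue probability space (formalized as a standard Borel space with a probability measure)
and `H_μ(𝒞) > 0`, then there is a dense `G_δ` set `G` in the space `Φ` of invertible measure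
preserving transformations (with the weak topology) such that the uniform mean ergodic theorem
fails for `T_φ = φ⁻¹ ∘ T ∘ φ` for every `φ ∈ G`. -/
theorem dense_Gdelta_uniform_mean_ergodic_fails_of_pos_entropy
    {X : Type*} [MeasurableSpace X] [StandardBorelSpace X]
    (μ : Measure X) [IsProbabilityMeasure μ]
    (T : X ≃ᵐ X) (hT : Ergodic (⇑T) μ)
    (𝒞 : Set (Set X)) (h𝒞 : ∀ C ∈ 𝒞, MeasurableSet C) (hent : 0 < famEntropy μ 𝒞) :
    ∃ G : Set (MPE μ), IsGδ G ∧ Dense G ∧ ∀ φ ∈ G,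
      0 < Filter.atTop.limsup (fun n : ℕ => ⨆ C : 𝒞, birkDev μ (MPE.conj T φ) C n) := by
  have hat := no_atoms μ T hT 𝒞 h𝒞 hent
  obtain ⟨lam, hprob, hl⟩ := coin_exists
  obtain ⟨e, he⟩ := iso_two (μ := μ) (ν := lam) hat (lam_singleton hl)
  obtain ⟨ε, hε, hex⟩ := exists_eps μ e he 𝒞 h𝒞 hent
  have h𝒞' : ∀ C' ∈ {C' | ∃ C ∈ 𝒞, C' = e.symm ⁻¹' C}, MeasurableSet C' := by
    rintro _ ⟨C, hC, rfl⟩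
    exact e.symm.measurable (h𝒞 C hC)
  have hTm := hT.toMeasurePreserving
  refine ⟨⋂ N : ℕ, {φ : MPE μ | ∃ n, N ≤ n ∧ ∃ C ∈ 𝒞, ε / 32 < birkDev μ (MPE.conj T φ) C n},
    IsGδ.iInter_of_isOpen fun N => ?_, ?_, ?_⟩
  · have : {φ : MPE μ | ∃ n, N ≤ n ∧ ∃ C ∈ 𝒞, ε / 32 < birkDev μ (MPE.conj T φ) C n} =
        ⋃ (n : ℕ) (_ : N ≤ n) (C : Set X) (_ : C ∈ 𝒞),
          {φ : MPE μ | ε / 32 < birkDev μ (MPE.conj T φ) C n} := by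
      ext φ
      simp
    rw [this]
    exact isOpen_iUnion fun n => isOpen_iUnion fun _ => isOpen_iUnion fun C =>
      isOpen_iUnion fun hC => isOpen_lt continuous_const (continuous_birkDev T hTm (h𝒞 C hC) n)
  · intro φ₀
    have hf : MeasurePreserving (e.symm.trans φ₀.1) lam μ := by
      have := MeasurePreserving.comp φ₀.2 (MeasurePreserving.symm e he)
      exact this
    have hT' := ergodic_conj hT (e.symm.trans φ₀.1) hf
    choose θ hθ hθm hθb using fun m => exists_theta hl hT' h𝒞' hε hex m
    let φ : ℕ → MPE μ := fun m => ⟨e.trans ((θ m).trans (e.symm.trans φ₀.1)), by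
      have := (hf.comp (hθ m)).comp he
      exact this⟩
    refine mem_closure_of_tendsto (tendsto_theta e he φ₀ θ hθ hθm φ fun m => rfl)
      (Eventually.of_forall fun m => Set.mem_iInter.2 fun N => ?_)
    obtain ⟨n, hn, _, ⟨C, hC, rfl⟩, hb⟩ := hθb m N
    refine ⟨n, hn, C, hC, ?_⟩
    rw [← birkDev_conj e he _ (h𝒞 C hC)] at hb
    exact lt_of_lt_of_le (by linarith) hb
  · intro φ hφ
    exact limsup_pos (MPE.conj T φ) 𝒞 (ε := ε / 32) (by positivity)
      fun k => Set.mem_iInter.1 hφ k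
end
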